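/- arXiv:math/0703343 — 5 statements merged into one kernel-verified Lean document; each statement's English description precedes it below -/
import Mathlib

section
/- Let G be a finite group of order n such that every nontrivial complex representation of G has degree at least k (k ≥ 1). If A, B, C are three subsets of G such that |A|·|B|·|C| > n³/k, then A·B·C = G, i.e., every element g ∈ G can be written as g = a·b·c with a ∈ A, b ∈ B, c ∈ C. -/
open Pointwise

/-- The left translation action of a group on a translation-invariant space of functions on it. -/
def leftTranslation {G : Type*} [Group G] (W : Submodule ℂ (G → ℂ))
    (hW : ∀ g : G, ∀ w ∈ W, (fun x => w (g⁻¹ * x)) ∈ W) : Representation ℂ G W where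
  toFun g :=
    { toFun := fun w => ⟨fun x => w.1 (g⁻¹ * x), hW g w.1 w.2⟩
      map_add' := fun _ _ => rfl
      map_smul' := fun _ _ => rfl }
  map_one' := by
    ext w x
    simp
  map_mul' g h := by
    ext w x
    simp [mul_assoc]

theorem leftTranslation_ne_one {G : Type*} [Group G] [Fintype G] {W : Submodule ℂ (G → ℂ)}
    (hW : ∀ g : G, ∀ w ∈ W, (fun x => w (g⁻¹ * x)) ∈ W) (hsum : ∀ w ∈ W, ∑ x, w x = 0)
    (hne : W ≠ ⊥) : leftTranslation W hW ≠ 1 := by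
  intro h
  obtain ⟨w, hw, hw0⟩ := W.ne_bot_iff.mp hne
  have hconst : ∀ x, w x = w 1 := fun x => by
    have := congrFun (congrArg Subtype.val (LinearMap.congr_fun (DFunLike.congr_fun h x)
      ⟨w, hw⟩)) x
    simpa [leftTranslation] using this.symm
  have hs := hsum w hw
  simp only [hconst, Finset.sum_const, Finset.card_univ, nsmul_eq_mul, mul_eq_zero,
    Nat.cast_eq_zero, Fintype.card_ne_zero, false_or] at hs
  exact hw0 (funext fun x => by rw [hconst, hs]; rfl)

/-- The matrix of right convolution by `f`. -/
def convMatrix {G : Type*} [Group G] (f : G → ℂ) : Matrix G G ℂ := Matrix.of fun x y => f (x⁻¹ * y)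

open Matrix in
theorem convMatrix_mulVec_translate {G : Type*} [Group G] [Fintype G] (f v : G → ℂ) (g : G) :
    convMatrix f *ᵥ (fun x => v (g⁻¹ * x)) = fun x => (convMatrix f *ᵥ v) (g⁻¹ * x) := by
  ext x
  simp only [convMatrix, mulVec, dotProduct, of_apply]
  refine Fintype.sum_equiv (Equiv.mulLeft g⁻¹) _ _ fun y => ?_
  simp [mul_assoc]

open Matrix in
theorem convMatrix_conjTranspose {G : Type*} [Group G] (f : G → ℂ) :
    (convMatrix f)ᴴ = convMatrix (fun x => star (f x⁻¹)) := by
  ext x y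
  simp [convMatrix]

open Matrix in
theorem sum_convMatrix_mulVec {G : Type*} [Group G] [Fintype G] {f : G → ℂ}
    (hf : ∑ x, f x = 0) (v : G → ℂ) : ∑ x, (convMatrix f *ᵥ v) x = 0 := by
  simp only [convMatrix, mulVec, dotProduct, of_apply]
  rw [Finset.sum_comm]
  refine Finset.sum_eq_zero fun y _ => ?_
  rw [← Finset.sum_mul]
  have : ∑ x, f (x⁻¹ * y) = ∑ x, f x :=
    Fintype.sum_equiv ((Equiv.inv G).trans (Equiv.mulRight y)) _ _ fun x => by simp
  rw [this, hf, zero_mul]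

open Matrix in
theorem trace_conjTranspose_mul_convMatrix {G : Type*} [Group G] [Fintype G] (f : G → ℂ) :
    ((convMatrix f)ᴴ * convMatrix f).trace = ((Fintype.card G * ∑ x, ‖f x‖ ^ 2 : ℝ) : ℂ) := by
  have h : ∀ y, ∑ x, ‖f (x⁻¹ * y)‖ ^ 2 = ∑ x, ‖f x‖ ^ 2 := fun y =>
    Fintype.sum_equiv ((Equiv.inv G).trans (Equiv.mulRight y)) _ _ fun x => by simp
  have h2 : ∀ y, ((convMatrix f)ᴴ * convMatrix f) y y = ((∑ x, ‖f x‖ ^ 2 : ℝ) : ℂ) := fun y => by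
    rw [← h y]
    simp [mul_apply, convMatrix, Complex.conj_mul']
  simp [trace, h2]

open Matrix in
theorem Matrix.IsHermitian.inner_eigenvectorBasis_mulVec {ι : Type*} [Fintype ι] [DecidableEq ι]
    {M : Matrix ι ι ℂ} (hM : M.IsHermitian) (j : ι) (v : ι → ℂ) :
    inner ℂ (hM.eigenvectorBasis j) (WithLp.toLp 2 (M *ᵥ v)) =
      (hM.eigenvalues j : ℂ) * inner ℂ (hM.eigenvectorBasis j) (WithLp.toLp 2 v) := by
  have h : star (⇑(hM.eigenvectorBasis j)) ᵥ* M =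
      (hM.eigenvalues j : ℂ) • star (⇑(hM.eigenvectorBasis j)) := by
    have := congrArg star (hM.mulVec_eigenvectorBasis j)
    rw [star_mulVec, show Mᴴ = M from hM] at this
    rw [this]
    ext x
    simp
  rw [EuclideanSpace.inner_eq_star_dotProduct, EuclideanSpace.inner_eq_star_dotProduct,
    dotProduct_comm, dotProduct_comm v]
  change star (⇑(hM.eigenvectorBasis j)) ⬝ᵥ (M *ᵥ v) = _
  rw [dotProduct_mulVec, h, smul_dotProduct, smul_eq_mul]

open Matrix in
theorem Matrix.IsHermitian.star_dotProduct_mulVec_eq_sum {ι : Type*} [Fintype ι] [DecidableEq ι]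
    {M : Matrix ι ι ℂ} (hM : M.IsHermitian) (v : ι → ℂ) :
    star v ⬝ᵥ (M *ᵥ v) = ((∑ i, hM.eigenvalues i *
      ‖inner ℂ (hM.eigenvectorBasis i) (WithLp.toLp 2 v)‖ ^ 2 : ℝ) : ℂ) := by
  have h := hM.eigenvectorBasis.sum_inner_mul_inner (WithLp.toLp 2 v) (WithLp.toLp 2 (M *ᵥ v))
  rw [EuclideanSpace.inner_eq_star_dotProduct (WithLp.toLp 2 v), dotProduct_comm] at h
  change _ = star v ⬝ᵥ (M *ᵥ v) at h
  rw [← h]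
  push_cast
  refine Finset.sum_congr rfl fun i _ => ?_
  rw [hM.inner_eigenvectorBasis_mulVec, ← Complex.conj_mul', inner_conj_symm]
  ring

open Matrix in
theorem Matrix.IsHermitian.finrank_eigenspace_le {ι : Type*} [Fintype ι] [DecidableEq ι]
    {M : Matrix ι ι ℂ} (hM : M.IsHermitian) (c : ℝ) :
    Module.finrank ℂ (Module.End.eigenspace (Matrix.toLin' M) (c : ℂ)) ≤
      (Finset.univ.filter fun j => hM.eigenvalues j = c).card := by
  let W := Module.End.eigenspace (Matrix.toLin' M) (c : ℂ)
  let φ : W →ₗ[ℂ] ({j // hM.eigenvalues j = c} → ℂ) :=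
    { toFun := fun w j => inner ℂ (hM.eigenvectorBasis j.1) (WithLp.toLp 2 w.1)
      map_add' := fun v w => by ext j; simp
      map_smul' := fun a w => by ext j; simp }
  have hφ : Function.Injective φ := by
    rw [injective_iff_map_eq_zero]
    intro w hw
    have hMw : M *ᵥ w.1 = (c : ℂ) • w.1 := by
      simpa using Module.End.mem_eigenspace_iff.mp w.2
    have hzero : ∀ j, inner ℂ (hM.eigenvectorBasis j) (WithLp.toLp 2 w.1) = 0 := fun j => by
      by_cases hj : hM.eigenvalues j = c
      · exact congrFun hw ⟨j, hj⟩
      · have h := hM.inner_eigenvectorBasis_mulVec j w.1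
        rw [hMw, WithLp.toLp_smul, inner_smul_right] at h
        by_contra hne
        exact hj (by exact_mod_cast (mul_right_cancel₀ hne h).symm)
    have := hM.eigenvectorBasis.sum_repr' (WithLp.toLp 2 w.1)
    simp only [hzero, zero_smul, Finset.sum_const_zero] at this
    ext i
    simpa using (congrArg (fun u : EuclideanSpace ℂ ι => u i) this).symm
  have := LinearMap.finrank_le_finrank_of_injective hφ
  rwa [Module.finrank_fintype_fun_eq_card, Fintype.card_subtype] at this

open Matrix ComplexOrder in
/-- A group without small nontrivial representations is quasirandom: convolution by a function of
mean zero has small operator norm. -/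
theorem norm_convMatrix_mulVec_le {G : Type} [Group G] [Fintype G] (k : ℕ)
    (hrep : ∀ (V : Type) [AddCommGroup V] [Module ℂ V] [FiniteDimensional ℂ V]
      (ρ : Representation ℂ G V), ρ ≠ 1 → k ≤ Module.finrank ℂ V)
    {f : G → ℂ} (hf : ∑ x, f x = 0) (v : G → ℂ) :
    k * ∑ x, ‖(convMatrix f *ᵥ v) x‖ ^ 2 ≤
      (Fintype.card G * ∑ x, ‖f x‖ ^ 2) * ∑ x, ‖v x‖ ^ 2 := by
  classical
  set N := convMatrix f with hN
  have hpsd : (Nᴴ * N).PosSemidef := posSemidef_conjTranspose_mul_self N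
  have hM : (Nᴴ * N).IsHermitian := hpsd.isHermitian
  have htr : ∑ i, hM.eigenvalues i = Fintype.card G * ∑ x, ‖f x‖ ^ 2 := by
    have := hM.trace_eq_sum_eigenvalues
    have h := this.symm.trans (trace_conjTranspose_mul_convMatrix f)
    exact Complex.ofReal_injective (by simpa using h)
  have hnn : ∀ i, 0 ≤ hM.eigenvalues i := hpsd.eigenvalues_nonneg
  have hf' : ∑ x, star (f x⁻¹) = 0 := by
    rw [← star_sum, Fintype.sum_equiv (Equiv.inv G) (fun x => f x⁻¹) f fun x => rfl, hf, star_zero]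
  have hev : ∀ i, k * hM.eigenvalues i ≤ ∑ j, hM.eigenvalues j := fun i => by
    rcases (hnn i).eq_or_lt with h0 | h0
    · rw [← h0, mul_zero]
      exact Finset.sum_nonneg fun j _ => hnn j
    set c := hM.eigenvalues i with hc
    have hc0 : (c : ℂ) ≠ 0 := by exact_mod_cast h0.ne'
    let W := Module.End.eigenspace (Matrix.toLin' (Nᴴ * N)) (c : ℂ)
    have hmem : ∀ w, w ∈ W ↔ Nᴴ *ᵥ (N *ᵥ w) = (c : ℂ) • w := fun w => by
      rw [Module.End.mem_eigenspace_iff, toLin'_apply, mulVec_mulVec]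
    have hW : ∀ g : G, ∀ w ∈ W, (fun x => w (g⁻¹ * x)) ∈ W := fun g w hw => by
      rw [hmem] at hw ⊢
      rw [hN, convMatrix_conjTranspose] at hw ⊢
      rw [convMatrix_mulVec_translate, convMatrix_mulVec_translate, hw]
      rfl
    have hsum : ∀ w ∈ W, ∑ x, w x = 0 := fun w hw => by
      rw [hmem, hN, convMatrix_conjTranspose] at hw
      have h1 := sum_convMatrix_mulVec hf' (convMatrix f *ᵥ w)
      rw [hw] at h1
      simp only [Pi.smul_apply, smul_eq_mul, ← Finset.mul_sum] at h1
      exact (mul_eq_zero.mp h1).resolve_left hc0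
    have hne : W ≠ ⊥ := by
      refine W.ne_bot_iff.mpr ⟨⇑(hM.eigenvectorBasis i), ?_, fun h => ?_⟩
      · rw [hmem, mulVec_mulVec, hM.mulVec_eigenvectorBasis]
        rfl
      · refine hM.eigenvectorBasis.orthonormal.ne_zero i ?_
        ext x
        exact congrFun h x
    have hk := (hrep W _ (leftTranslation_ne_one hW hsum hne)).trans (hM.finrank_eigenspace_le c)
    calc (k : ℝ) * c ≤ (Finset.univ.filter fun j => hM.eigenvalues j = c).card * c := by
          gcongr
      _ = ∑ j ∈ Finset.univ.filter (fun j => hM.eigenvalues j = c), hM.eigenvalues j := by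
          rw [Finset.sum_congr rfl fun j hj => (Finset.mem_filter.mp hj).2]
          simp
      _ ≤ _ := Finset.sum_le_sum_of_subset_of_nonneg (Finset.subset_univ _) fun j _ _ => hnn j
  have hquad : ∑ x, ‖(N *ᵥ v) x‖ ^ 2 = ∑ i, hM.eigenvalues i *
      ‖inner ℂ (hM.eigenvectorBasis i) (WithLp.toLp 2 v)‖ ^ 2 := by
    have h := hM.star_dotProduct_mulVec_eq_sum v
    rw [← mulVec_mulVec, dotProduct_mulVec, ← star_mulVec] at h
    have h' : star (N *ᵥ v) ⬝ᵥ (N *ᵥ v) = ((∑ x, ‖(N *ᵥ v) x‖ ^ 2 : ℝ) : ℂ) := by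
      simp [dotProduct, Complex.conj_mul']
    exact_mod_cast h'.symm.trans h
  have hnorm := hM.eigenvectorBasis.sum_sq_norm_inner_right (WithLp.toLp 2 v)
  rw [EuclideanSpace.norm_sq_eq] at hnorm
  rw [← htr, hquad, ← hnorm, Finset.mul_sum, Finset.mul_sum]
  refine Finset.sum_le_sum fun i _ => ?_
  rw [← mul_assoc]
  exact mul_le_mul_of_nonneg_right (hev i) (sq_nonneg _)

theorem statement1 {G : Type} [Group G] [Fintype G] [DecidableEq G] (n k : ℕ)
    (hn : Fintype.card G = n) (hk : 1 ≤ k)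
    (hrep : ∀ (V : Type) [AddCommGroup V] [Module ℂ V] [FiniteDimensional ℂ V]
      (ρ : Representation ℂ G V), ρ ≠ 1 → k ≤ Module.finrank ℂ V)
    (A B C : Finset G)
    (hABC : n ^ 3 < k * (A.card * B.card * C.card)) :
    A * B * C = (Finset.univ : Finset G) := by
  subst hn
  rw [Finset.eq_univ_iff_forall]
  intro g
  by_contra hg
  have hn0 : (0 : ℝ) < Fintype.card G := by exact_mod_cast Fintype.card_pos
  set n : ℝ := (Fintype.card G : ℝ) with hn
  set β : ℝ := B.card / n with hβ
  let f : G → ℂ := fun x => ((if x ∈ B then 1 else 0) - β : ℝ)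
  let v : G → ℂ := fun y => if y⁻¹ * g ∈ C then 1 else 0
  have hf : ∑ x, f x = 0 := by
    have : ∑ x : G, ((if x ∈ B then 1 else 0) - β : ℝ) = 0 := by
      simp only [Finset.sum_sub_distrib, Finset.sum_boole, Finset.filter_univ_mem,
        Finset.sum_const, Finset.card_univ, nsmul_eq_mul]
      rw [hβ]
      field_simp
      simp [hn]
    simp only [f]
    exact_mod_cast this
  have hcount : ∑ y : G, (if y⁻¹ * g ∈ C then 1 else 0 : ℝ) = C.card := by
    rw [Fintype.sum_equiv ((Equiv.inv G).trans (Equiv.mulRight g)) _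
      (fun y => if y ∈ C then (1 : ℝ) else 0) fun y => by simp]
    simp
  have hv : ∑ y, ‖v y‖ ^ 2 = C.card := by
    rw [← hcount]
    exact Finset.sum_congr rfl fun y _ => by simp only [v]; split_ifs <;> simp
  have hfn : ∑ x, ‖f x‖ ^ 2 ≤ B.card := by
    have h : ∀ x, ‖f x‖ ^ 2 = (1 - 2 * β) * (if x ∈ B then 1 else 0) + β ^ 2 := fun x => by
      simp only [f, Complex.norm_real, Real.norm_eq_abs, sq_abs]
      split_ifs <;> ring
    simp only [h, Finset.sum_add_distrib, ← Finset.mul_sum, Finset.sum_boole,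
      Finset.filter_univ_mem, Finset.sum_const, Finset.card_univ, nsmul_eq_mul]
    have hb : n * β = B.card := by rw [hβ]; field_simp
    have hβ0 : 0 ≤ β := by positivity
    rw [← hn, ← hb]
    nlinarith [mul_nonneg hn0.le (sq_nonneg β)]
  have hval : ∀ a ∈ A, (convMatrix f).mulVec v a = ((-(β * C.card) : ℝ) : ℂ) := fun a ha => by
    rw [← hcount, Finset.mul_sum, ← Finset.sum_neg_distrib]
    push_cast
    refine Finset.sum_congr rfl fun y _ => ?_
    simp only [convMatrix, Matrix.of_apply, f, v]
    by_cases hC : y⁻¹ * g ∈ C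
    · have hB : a⁻¹ * y ∉ B := fun hB => hg <| by
        have := Finset.mul_mem_mul (Finset.mul_mem_mul ha hB) hC
        simpa [mul_assoc] using this
      simp [hC, hB]
    · simp [hC]
  have hlow : A.card * (β * C.card) ^ 2 ≤ ∑ x, ‖(convMatrix f).mulVec v x‖ ^ 2 := by
    calc (A.card * (β * C.card) ^ 2 : ℝ) = ∑ a ∈ A, ‖(convMatrix f).mulVec v a‖ ^ 2 := by
          rw [Finset.sum_congr rfl fun a ha => by
            rw [hval a ha, Complex.norm_real, Real.norm_eq_abs, sq_abs, neg_sq]]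
          simp
      _ ≤ _ := Finset.sum_le_sum_of_subset_of_nonneg (Finset.subset_univ _)
          fun _ _ _ => sq_nonneg _
  have hmain := norm_convMatrix_mulVec_le k hrep hf v
  rw [hv] at hmain
  have hpos : 0 < k * (A.card * B.card * C.card) := hABC.pos
  have hB : (0 : ℝ) < B.card := by
    exact_mod_cast Nat.pos_of_ne_zero fun h => by simp [h] at hpos
  have hC : (0 : ℝ) < C.card := by
    exact_mod_cast Nat.pos_of_ne_zero fun h => by simp [h] at hpos
  have hfin : k * (A.card * (β * C.card) ^ 2) ≤ n * B.card * C.card :=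
    (mul_le_mul_of_nonneg_left hlow k.cast_nonneg).trans (hmain.trans (by gcongr))
  have hABC' : n ^ 3 < k * (A.card * B.card * C.card) := by rw [hn]; exact_mod_cast hABC
  have heq : k * (A.card * (β * C.card) ^ 2) * n ^ 2 =
      k * (A.card * B.card * C.card) * (B.card * C.card) := by
    rw [hβ]
    field_simp
  have h1 := mul_le_mul_of_nonneg_right hfin (sq_nonneg n)
  rw [heq] at h1
  have h2 := mul_lt_mul_of_pos_right hABC' (mul_pos hB hC)
  linarith [show n * B.card * C.card * n ^ 2 = n ^ 3 * (B.card * C.card) by ring]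
end

section
/- Let G be a finite group of order n such that every nontrivial complex representation of G has degree at least k (k ≥ 1). If B is a subset of G with |B|³·k > n³ (i.e., |B| > n/k^{1/3}), then B³ = G, i.e., every element of G is a product of three elements of B. -/
open Pointwise

theorem LinearMap.IsSymmetric.finrank_eigenspace_le_card {E : Type*} [NormedAddCommGroup E]
    [InnerProductSpace ℂ E] [FiniteDimensional ℂ E] {T : E →ₗ[ℂ] E} (hT : T.IsSymmetric)
    {n : ℕ} (hn : Module.finrank ℂ E = n) (μ : ℝ) :
    Module.finrank ℂ (Module.End.eigenspace T (μ : ℂ)) ≤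
      (Finset.univ.filter fun i => hT.eigenvalues hn i = μ).card := by
  classical
  set b := hT.eigenvectorBasis hn
  have hle : Module.End.eigenspace T (μ : ℂ) ≤
      Submodule.span ℂ (((Finset.univ.filter fun i => hT.eigenvalues hn i = μ).image b : Finset E) :
        Set E) := by
    intro v hv
    rw [Module.End.mem_eigenspace_iff] at hv
    rw [← b.sum_repr v]
    refine Submodule.sum_mem _ fun i _ => ?_
    by_cases hi : hT.eigenvalues hn i = μ
    · exact Submodule.smul_mem _ _ (Submodule.subset_span (by
        simpa using ⟨i, hi, rfl⟩))
    · have h := hT.eigenvectorBasis_apply_self_apply hn v i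
      rw [hv, map_smul] at h
      have h0 : ((μ : ℂ) - hT.eigenvalues hn i) * b.repr v i = 0 := by
        rw [sub_mul, sub_eq_zero]
        exact h
      rcases mul_eq_zero.mp h0 with h1 | h1
      · exact absurd (by exact_mod_cast (sub_eq_zero.mp h1).symm) hi
      · simp [h1]
  exact (Submodule.finrank_mono hle).trans
    ((finrank_span_finset_le_card _).trans Finset.card_image_le)

theorem LinearMap.IsPositive.mul_inner_le_trace_mul {E : Type*} [NormedAddCommGroup E]
    [InnerProductSpace ℂ E] [FiniteDimensional ℂ E] {T : E →ₗ[ℂ] E} (hT : T.IsPositive) (k : ℕ)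
    (hk : ∀ μ : ℝ, 0 < μ → Module.End.HasEigenvalue T (μ : ℂ) →
      k ≤ Module.finrank ℂ (Module.End.eigenspace T (μ : ℂ))) (v : E) :
    k * (inner ℂ v (T v)).re ≤ (LinearMap.trace ℂ E T).re * ‖v‖ ^ 2 := by
  classical
  have hs := hT.isSymmetric
  set ev := hs.eigenvalues rfl
  set b := hs.eigenvectorBasis rfl with hb
  have hev : ∀ i, 0 ≤ ev i := hT.nonneg_eigenvalues rfl
  have htr : (LinearMap.trace ℂ E T).re = ∑ i, ev i := hs.re_trace_eq_sum_eigenvalues rfl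
  have hbound : ∀ i, k * ev i ≤ (LinearMap.trace ℂ E T).re := by
    intro i
    rw [htr]
    rcases (hev i).eq_or_lt with h0 | h0
    · rw [← h0, mul_zero]
      exact Finset.sum_nonneg fun j _ => hev j
    · calc k * ev i ≤ ((Finset.univ.filter fun j => ev j = ev i).card : ℝ) * ev i := by
            gcongr
            exact (hk _ h0 (hs.hasEigenvalue_eigenvalues rfl i)).trans
              (hs.finrank_eigenspace_le_card rfl _)
        _ = ∑ j ∈ Finset.univ.filter fun j => ev j = ev i, ev j := by
            rw [Finset.sum_congr rfl fun j hj => (Finset.mem_filter.mp hj).2]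
            simp
        _ ≤ ∑ j, ev j := Finset.sum_le_univ_sum_of_nonneg hev
  have hin : (inner ℂ v (T v)).re = ∑ i, ev i * ‖inner ℂ (b i) v‖ ^ 2 := by
    rw [← b.sum_inner_mul_inner v (T v), Complex.re_sum]
    refine Finset.sum_congr rfl fun i _ => ?_
    rw [← hs (b i) v, hb, hs.apply_eigenvectorBasis, inner_smul_left, ← hb,
      ← inner_conj_symm v (b i)]
    rw [mul_left_comm, Complex.conj_mul']
    simp [← Complex.ofReal_pow, ev]
  rw [hin, ← b.sum_sq_norm_inner_right v, Finset.mul_sum, Finset.mul_sum]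
  refine Finset.sum_le_sum fun i _ => ?_
  rw [← mul_assoc]
  exact mul_le_mul_of_nonneg_right (hbound i) (by positivity)

/-- Right translation of functions on a finite group. -/
noncomputable def rightTranslation (G : Type*) [Group G] :
    Representation ℂ G (EuclideanSpace ℂ G) where
  toFun g :=
    { toFun := fun f => WithLp.toLp 2 fun x => f (x * g)
      map_add' := fun _ _ => rfl
      map_smul' := fun _ _ => rfl }
  map_one' := by ext; simp
  map_mul' g h := by
    ext f x
    exact congrArg f (mul_assoc x g h).symm

@[simp]
theorem rightTranslation_apply {G : Type*} [Group G] (g : G) (f : EuclideanSpace ℂ G) (x : G) :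
    rightTranslation G g f x = f (x * g) := rfl

theorem sum_mul_inv_left {G : Type*} [Group G] [Fintype G] (φ : G → ℝ) (x : G) :
    ∑ y, φ (x * y⁻¹) = ∑ y, φ y :=
  Fintype.sum_equiv ((Equiv.inv G).trans (Equiv.mulLeft x)) _ _ fun _ => rfl

section Convolution

variable {G : Type*} [Group G] [Fintype G] [DecidableEq G]

/-- Left convolution by a real function on a finite group. -/
noncomputable def convolutionOperator (φ : G → ℝ) : EuclideanSpace ℂ G →ₗ[ℂ] EuclideanSpace ℂ G :=
  Matrix.toEuclideanLin (Matrix.of fun x y => (φ (x * y⁻¹) : ℂ))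

theorem convolutionOperator_apply (φ : G → ℝ) (f : EuclideanSpace ℂ G) (x : G) :
    convolutionOperator φ f x = ∑ y, (φ (x * y⁻¹) : ℂ) * f y := by
  simp [convolutionOperator, Matrix.mulVec, dotProduct]

theorem adjoint_convolutionOperator (φ : G → ℝ) :
    (convolutionOperator φ).adjoint = convolutionOperator fun x => φ x⁻¹ := by
  rw [convolutionOperator, ← Matrix.toEuclideanLin_conjTranspose_eq_adjoint, convolutionOperator]
  congr 1
  ext x y
  simp

theorem convolutionOperator_rightTranslation (φ : G → ℝ) (g : G) (f : EuclideanSpace ℂ G) :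
    convolutionOperator φ (rightTranslation G g f) =
      rightTranslation G g (convolutionOperator φ f) := by
  ext x
  simp only [convolutionOperator_apply, rightTranslation_apply]
  exact Fintype.sum_equiv (Equiv.mulRight g) _ _ fun y => by simp [mul_assoc]

theorem convolutionOperator_eq_zero_of_fixed {φ : G → ℝ} (hφ : ∑ x, φ x = 0)
    {f : EuclideanSpace ℂ G} (hf : ∀ g, rightTranslation G g f = f) :
    convolutionOperator φ f = 0 := by
  have hconst : ∀ y, f y = f 1 := fun y => by
    conv_rhs => rw [← hf y]
    simp
  ext x
  rw [convolutionOperator_apply]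
  simp_rw [hconst]
  rw [← Finset.sum_mul, ← Complex.ofReal_sum, sum_mul_inv_left, hφ]
  simp

theorem re_trace_adjoint_comp_convolutionOperator (φ : G → ℝ) :
    (LinearMap.trace ℂ _ ((convolutionOperator φ).adjoint ∘ₗ convolutionOperator φ)).re =
      Fintype.card G * ∑ x, φ x ^ 2 := by
  rw [LinearMap.trace_eq_sum_inner _ (EuclideanSpace.basisFun G ℂ), Complex.re_sum]
  have h : ∀ i : G, (inner ℂ (EuclideanSpace.basisFun G ℂ i)
      (((convolutionOperator φ).adjoint ∘ₗ convolutionOperator φ)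
        (EuclideanSpace.basisFun G ℂ i))).re = ∑ x, φ x ^ 2 := by
    intro i
    rw [LinearMap.comp_apply, LinearMap.adjoint_inner_right]
    have := inner_self_eq_norm_sq (𝕜 := ℂ) (convolutionOperator φ (EuclideanSpace.basisFun G ℂ i))
    rw [RCLike.re_eq_complex_re] at this
    rw [this, EuclideanSpace.norm_sq_eq]
    refine Fintype.sum_equiv (Equiv.mulRight i⁻¹) _ _ fun x => ?_
    simp [convolutionOperator_apply]
  rw [Finset.sum_congr rfl fun i _ => h i]
  simp

end Convolution

theorem mul_norm_sq_convolutionOperator_le {G : Type} [Group G] [Fintype G] [DecidableEq G] {k : ℕ}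
    (hrep : ∀ (V : Type) [AddCommGroup V] [Module ℂ V] [FiniteDimensional ℂ V]
      (ρ : Representation ℂ G V), ρ ≠ 1 → k ≤ Module.finrank ℂ V)
    {φ : G → ℝ} (hφ : ∑ x, φ x = 0) (f : EuclideanSpace ℂ G) :
    k * ‖convolutionOperator φ f‖ ^ 2 ≤ (Fintype.card G * ∑ x, φ x ^ 2) * ‖f‖ ^ 2 := by
  set T := (convolutionOperator φ).adjoint ∘ₗ convolutionOperator φ with hT
  have hcomm : ∀ g f, T (rightTranslation G g f) = rightTranslation G g (T f) := fun g f => by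
    simp only [hT, adjoint_convolutionOperator, LinearMap.comp_apply,
      convolutionOperator_rightTranslation]
  have hpos : T.IsPositive := LinearMap.isPositive_adjoint_comp_self _
  have key := hpos.mul_inner_le_trace_mul k (fun μ hμ hev => ?_) f
  · have := inner_self_eq_norm_sq (𝕜 := ℂ) (convolutionOperator φ f)
    rw [RCLike.re_eq_complex_re] at this
    rwa [hT, re_trace_adjoint_comp_convolutionOperator, LinearMap.comp_apply,
      LinearMap.adjoint_inner_right, this] at key
  · refine hrep _ ((rightTranslation G).subrepresentation
      (Module.End.eigenspace T (μ : ℂ)) fun g v hv => ?_) fun h1 => ?_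
    · rw [Module.End.mem_eigenspace_iff] at hv
      rw [Submodule.mem_comap, Module.End.mem_eigenspace_iff, hcomm, hv, map_smul]
    · obtain ⟨v, hv, hv0⟩ := hev.exists_hasEigenvector
      have hfix : ∀ g, rightTranslation G g v = v := fun g =>
        congrArg Subtype.val (LinearMap.congr_fun (DFunLike.congr_fun h1 g) ⟨v, hv⟩)
      rw [Module.End.mem_eigenspace_iff, hT, LinearMap.comp_apply,
        convolutionOperator_eq_zero_of_fixed hφ hfix, map_zero] at hv
      rcases smul_eq_zero.mp hv.symm with h | h
      · exact hμ.ne' (by exact_mod_cast h)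
      · exact hv0 h

theorem mul_sq_sum_convolution_le {G : Type} [Group G] [Fintype G] [DecidableEq G] {k : ℕ}
    (hrep : ∀ (V : Type) [AddCommGroup V] [Module ℂ V] [FiniteDimensional ℂ V]
      (ρ : Representation ℂ G V), ρ ≠ 1 → k ≤ Module.finrank ℂ V)
    {φ : G → ℝ} (hφ : ∑ x, φ x = 0) (g : G) :
    k * (∑ x, (∑ y, φ (x * y⁻¹) * φ y) * φ (x⁻¹ * g)) ^ 2 ≤
      Fintype.card G * (∑ x, φ x ^ 2) ^ 3 := by
  have h := mul_norm_sq_convolutionOperator_le hrep hφ (WithLp.toLp 2 fun x => (φ x : ℂ))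
  have hnorm : ‖convolutionOperator φ (WithLp.toLp 2 fun x => (φ x : ℂ))‖ ^ 2 =
      ∑ x, (∑ y, φ (x * y⁻¹) * φ y) ^ 2 := by
    rw [EuclideanSpace.norm_sq_eq]
    refine Finset.sum_congr rfl fun x _ => ?_
    rw [convolutionOperator_apply]
    simp only [← Complex.ofReal_mul, ← Complex.ofReal_sum, Complex.norm_real, Real.norm_eq_abs,
      sq_abs]
  have hnorm' : ‖(WithLp.toLp 2 fun x => (φ x : ℂ) : EuclideanSpace ℂ G)‖ ^ 2 =
      ∑ x, φ x ^ 2 := by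
    simp [EuclideanSpace.norm_sq_eq]
  have hrefl : ∑ x, φ (x⁻¹ * g) ^ 2 = ∑ x, φ x ^ 2 :=
    Fintype.sum_equiv ((Equiv.inv G).trans (Equiv.mulRight g)) _ _ fun _ => rfl
  rw [hnorm, hnorm'] at h
  calc _ ≤ (k : ℝ) * ((∑ x, (∑ y, φ (x * y⁻¹) * φ y) ^ 2) * ∑ x, φ (x⁻¹ * g) ^ 2) := by
        gcongr
        exact Finset.sum_mul_sq_le_sq_mul_sq _ _ _
    _ = (k * ∑ x, (∑ y, φ (x * y⁻¹) * φ y) ^ 2) * ∑ x, φ x ^ 2 := by rw [hrefl]; ring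
    _ ≤ (Fintype.card G * (∑ x, φ x ^ 2) * ∑ x, φ x ^ 2) * ∑ x, φ x ^ 2 := by
        gcongr
    _ = _ := by ring

theorem sum_convolution_add_const {G : Type*} [Group G] [Fintype G] {φ : G → ℝ}
    (hφ : ∑ x, φ x = 0) (β : ℝ) (g : G) :
    ∑ x, (∑ y, (φ (x * y⁻¹) + β) * (φ y + β)) * (φ (x⁻¹ * g) + β) =
      ∑ x, (∑ y, φ (x * y⁻¹) * φ y) * φ (x⁻¹ * g) + (Fintype.card G : ℝ) ^ 2 * β ^ 3 := by
  have hinner : ∀ x, ∑ y, (φ (x * y⁻¹) + β) * (φ y + β) =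
      ∑ y, φ (x * y⁻¹) * φ y + Fintype.card G * β ^ 2 := fun x => by
    simp only [add_mul, mul_add, Finset.sum_add_distrib, ← Finset.sum_mul, ← Finset.mul_sum,
      sum_mul_inv_left, hφ]
    simp
    ring
  have hrefl : ∑ x, φ (x⁻¹ * g) = 0 := by
    rw [← hφ]
    exact Fintype.sum_equiv ((Equiv.inv G).trans (Equiv.mulRight g)) _ _ fun _ => rfl
  have hconv : ∑ x, ∑ y, φ (x * y⁻¹) * φ y = 0 := by
    rw [Finset.sum_comm]
    refine Finset.sum_eq_zero fun y _ => ?_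
    rw [← Finset.sum_mul, Fintype.sum_equiv (Equiv.mulRight y⁻¹) (fun x => φ (x * y⁻¹)) φ
      fun _ => rfl, hφ, zero_mul]
  simp_rw [hinner, mul_add, Finset.sum_add_distrib, ← Finset.sum_mul, Finset.sum_add_distrib,
    hconv, add_mul, Finset.sum_add_distrib, ← Finset.mul_sum, hrefl]
  simp
  ring


/-- **Corollary 1, second part**: if every nontrivial complex representation of the
finite group `G` of order `n` has degree at least `k`, and `B ⊆ G` satisfies
`|B|³·k > n³` (i.e. `|B| > n/k^{1/3}`), then `B³ = G`. -/
theorem statement2 {G : Type} [Group G] [Fintype G] [DecidableEq G] (n k : ℕ)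
    (hn : Fintype.card G = n) (hk : 1 ≤ k)
    (hrep : ∀ (V : Type) [AddCommGroup V] [Module ℂ V] [FiniteDimensional ℂ V]
      (ρ : Representation ℂ G V), ρ ≠ 1 → k ≤ Module.finrank ℂ V)
    (B : Finset G)
    (hB : n ^ 3 < B.card ^ 3 * k) :
    B * B * B = (Finset.univ : Finset G) := by
  have hn0 : (0 : ℝ) < n := by
    rw [← hn]
    exact_mod_cast Fintype.card_pos
  have hm0 : (0 : ℝ) < B.card := by
    rcases Nat.eq_zero_or_pos B.card with h | h
    · simp [h] at hB
    · exact_mod_cast h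
  set β : ℝ := B.card / n with hβ
  set φ : G → ℝ := fun x => (if x ∈ B then 1 else 0) - β with hφdef
  have hβn : n * β = B.card := by rw [hβ]; field_simp
  have hφ : ∑ x, φ x = 0 := by
    simp [hφdef, Finset.sum_sub_distrib, hn, hβn]
  have hsq : ∑ x, φ x ^ 2 ≤ B.card := by
    have h : ∀ x, φ x ^ 2 = φ x * (1 - 2 * β) + β * (1 - β) := fun x => by
      simp only [hφdef]
      split_ifs <;> ring
    simp only [h, Finset.sum_add_distrib, ← Finset.sum_mul, hφ]
    simp only [zero_mul, Finset.sum_const, Finset.card_univ, hn, nsmul_eq_mul, zero_add]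
    rw [hβn]
    have : 0 ≤ β := by positivity
    nlinarith
  refine Finset.eq_univ_of_forall fun g => ?_
  by_contra hg
  have hzero : ∑ x, (∑ y, (φ (x * y⁻¹) + β) * (φ y + β)) * (φ (x⁻¹ * g) + β) = 0 := by
    refine Finset.sum_eq_zero fun x _ => ?_
    rw [Finset.sum_mul]
    refine Finset.sum_eq_zero fun y _ => ?_
    by_contra hne
    refine hg ?_
    simp only [hφdef, sub_add_cancel, mul_eq_zero, not_or, ite_eq_right_iff, one_ne_zero,
      imp_false, not_not] at hne
    have h := Finset.mul_mem_mul (Finset.mul_mem_mul hne.1.1 hne.1.2) hne.2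
    simpa using h
  rw [sum_convolution_add_const hφ, hn] at hzero
  have key := mul_sq_sum_convolution_le hrep hφ g
  rw [eq_neg_of_add_eq_zero_left hzero, hn] at key
  have hle : (k : ℝ) * (n ^ 2 * β ^ 3) ^ 2 ≤ n * B.card ^ 3 := by
    rw [neg_sq] at key
    refine key.trans ?_
    have : 0 ≤ ∑ x, φ x ^ 2 := Finset.sum_nonneg fun _ _ => sq_nonneg _
    gcongr
  have hBr : (n : ℝ) ^ 3 < B.card ^ 3 * k := by exact_mod_cast hB
  have hfin : (n : ℝ) * (B.card : ℝ) ^ 3 * (B.card ^ 3 * k) ≤ n * B.card ^ 3 * n ^ 3 := by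
    calc (n : ℝ) * (B.card : ℝ) ^ 3 * (B.card ^ 3 * k)
        = (n : ℝ) ^ 3 * (k * (n ^ 2 * β ^ 3) ^ 2) := by rw [← hβn]; ring
      _ ≤ (n : ℝ) ^ 3 * (n * (B.card : ℝ) ^ 3) := by gcongr
      _ = _ := by ring
  exact absurd (le_of_mul_le_mul_left hfin (by positivity)) (not_le.mpr hBr)
end

section
/- Let q be a prime power, n ≥ 2, and let L = PSL(n, q) (the quotient of SL(n, F) by its center, where F is the finite field with q elements); assume L is a nonabelian simple group. If B is a subset of L of size at least 2|L|/q^{(n-1)/3}, then B³ = L, i.e., every element of L is a product of three elements of B. -/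
open Pointwise

/-- `PSL n F`: the projective special linear group, i.e. the quotient of
`SL(n, F)` by its center. -/
abbrev PSL (n : ℕ) (F : Type) [Field F] : Type :=
  Matrix.SpecialLinearGroup (Fin n) F ⧸
    Subgroup.center (Matrix.SpecialLinearGroup (Fin n) F)

open Matrix ComplexOrder in
/-- If all nonzero eigenvalues of `Aᴴ * A` have multiplicity at least `k`, then `k` times the square
of the operator norm of `A` is at most the square of its Frobenius norm. -/
theorem Matrix.mul_sum_norm_mulVec_sq_le {ι : Type*} [Fintype ι] [DecidableEq ι]
    (A : Matrix ι ι ℂ) (k : ℝ)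
    (hk : ∀ μ : ℂ, μ ≠ 0 → Module.End.HasEigenvalue (Aᴴ * A).toLin' μ →
      k ≤ Module.finrank ℂ (Module.End.eigenspace (Aᴴ * A).toLin' μ)) (g : ι → ℂ) :
    k * ∑ x, ‖(A *ᵥ g) x‖ ^ 2 ≤ (∑ x, ∑ y, ‖A x y‖ ^ 2) * ∑ x, ‖g x‖ ^ 2 := by
  have hpsd : (Aᴴ * A).PosSemidef := posSemidef_conjTranspose_mul_self A
  have hH : (Aᴴ * A).IsHermitian := hpsd.isHermitian
  set b := hH.eigenvectorBasis
  set l := hH.eigenvalues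
  have hl0 : ∀ i, 0 ≤ l i := hpsd.eigenvalues_nonneg
  have hb_mul : ∀ j, (Aᴴ * A) *ᵥ ⇑(b j) = (l j : ℂ) • ⇑(b j) := fun j ↦ by
    simpa using hH.mulVec_eigenvectorBasis j
  have htrace : ∑ i, l i = ∑ x, ∑ y, ‖A x y‖ ^ 2 := by
    have h := hH.trace_eq_sum_eigenvalues
    have h2 : (Aᴴ * A).trace = ((∑ x, ∑ y, ‖A x y‖ ^ 2 : ℝ) : ℂ) := by
      rw [Finset.sum_comm]
      simp [trace, mul_apply, Complex.conj_mul']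
    rw [h2] at h
    apply Complex.ofReal_injective
    rw [h, Complex.ofReal_sum]
    rfl
  have hcoord : ∀ (j : ι) (u : ι → ℂ),
      inner ℂ (b j) (WithLp.toLp 2 ((Aᴴ * A) *ᵥ u)) = l j * inner ℂ (b j) (WithLp.toLp 2 u) := by
    intro j u
    simp only [EuclideanSpace.inner_eq_star_dotProduct]
    rw [← dotProduct_comm, dotProduct_mulVec, ← dotProduct_comm, ← star_star (star (b j).ofLp ᵥ* _),
      star_vecMul, star_star, hH.eq, hb_mul]
    simp
  have hmult : ∀ i, k * l i ≤ ∑ x, ∑ y, ‖A x y‖ ^ 2 := by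
    intro i
    rcases eq_or_ne (l i) 0 with h0 | h0
    · rw [h0, mul_zero]; positivity
    set W := Module.End.eigenspace (Aᴴ * A).toLin' (l i : ℂ)
    have hW : k ≤ Module.finrank ℂ W := by
      refine hk _ (by exact_mod_cast h0) ?_
      refine Module.End.hasEigenvalue_of_hasEigenvector (x := (b i).ofLp) ⟨?_, ?_⟩
      · rw [Module.End.mem_eigenspace_iff, toLin'_apply, hb_mul]
      · exact (WithLp.ofLp_eq_zero 2).ne.2 (b.orthonormal.ne_zero i)
    set S : Finset ι := Finset.univ.filter fun j ↦ l j = l i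
    have hWS : W ≤ Submodule.span ℂ ((S.image fun j ↦ (b j).ofLp : Finset (ι → ℂ)) : Set (ι → ℂ)) := by
      intro u hu
      rw [Module.End.mem_eigenspace_iff, toLin'_apply] at hu
      have hsum : u = ∑ j, inner ℂ (b j) (WithLp.toLp 2 u) • (b j).ofLp := by
        have := congrArg WithLp.ofLp (b.sum_repr' (WithLp.toLp 2 u))
        simpa using this.symm
      rw [hsum]
      refine Submodule.sum_mem _ fun j _ ↦ ?_
      by_cases hj : l j = l i
      · exact Submodule.smul_mem _ _ (Submodule.subset_span (by
          simpa [S] using ⟨j, hj, rfl⟩))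
      · have h := hcoord j u
        rw [hu, WithLp.toLp_smul, inner_smul_right] at h
        have h' : inner ℂ (b j) (WithLp.toLp 2 u) = 0 := by
          have : ((l j : ℂ) - l i) * inner ℂ (b j) (WithLp.toLp 2 u) = 0 := by
            rw [sub_mul, h, sub_self]
          refine (mul_eq_zero.1 this).resolve_left ?_
          exact sub_ne_zero.2 (by exact_mod_cast hj)
        rw [h', zero_smul]
        exact Submodule.zero_mem _
    have hcard : Module.finrank ℂ W ≤ S.card :=
      (Submodule.finrank_mono hWS).trans
        ((finrank_span_finset_le_card _).trans Finset.card_image_le)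
    calc k * l i ≤ S.card * l i :=
          mul_le_mul_of_nonneg_right (hW.trans (by exact_mod_cast hcard)) (hl0 i)
      _ = ∑ j ∈ S, l j := by
          rw [Finset.sum_congr rfl (fun j hj ↦ (Finset.mem_filter.1 hj).2), Finset.sum_const,
            nsmul_eq_mul]
      _ ≤ ∑ j, l j := Finset.sum_le_univ_sum_of_nonneg hl0
      _ = _ := htrace
  have hnorm : ∑ x, ‖(A *ᵥ g) x‖ ^ 2 = ∑ j, l j * ‖inner ℂ (b j) (WithLp.toLp 2 g)‖ ^ 2 := by
    have h1 : ((∑ x, ‖(A *ᵥ g) x‖ ^ 2 : ℝ) : ℂ)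
        = inner ℂ (WithLp.toLp 2 g) (WithLp.toLp 2 ((Aᴴ * A) *ᵥ g)) := by
      rw [EuclideanSpace.inner_toLp_toLp, ← mulVec_mulVec, ← dotProduct_comm, dotProduct_mulVec,
        vecMul_conjTranspose, star_star]
      simp [dotProduct, Complex.conj_mul']
    rw [← b.sum_inner_mul_inner] at h1
    simp_rw [hcoord] at h1
    have h2 : ∀ j, inner ℂ (WithLp.toLp 2 g) (b j) * (l j * inner ℂ (b j) (WithLp.toLp 2 g))
        = ((l j * ‖inner ℂ (b j) (WithLp.toLp 2 g)‖ ^ 2 : ℝ) : ℂ) := by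
      intro j
      rw [← inner_conj_symm (WithLp.toLp 2 g) (b j), mul_left_comm, Complex.conj_mul']
      push_cast
      rfl
    simp_rw [h2] at h1
    exact_mod_cast h1
  have hparseval : ∑ x, ‖g x‖ ^ 2 = ∑ j, ‖inner ℂ (b j) (WithLp.toLp 2 g)‖ ^ 2 := by
    rw [b.sum_sq_norm_inner_right, EuclideanSpace.norm_sq_eq]
  rw [hnorm, hparseval, Finset.mul_sum, Finset.mul_sum]
  refine Finset.sum_le_sum fun j _ ↦ ?_
  rw [← mul_assoc]
  exact mul_le_mul_of_nonneg_right (hmult j) (by positivity)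

open Matrix in
theorem Matrix.mulVec_comp_mul_left {G : Type*} [Group G] [Fintype G] {N : Matrix G G ℂ}
    (hN : ∀ h x y, N (h * x) (h * y) = N x y) (g : G → ℂ) (h : G) :
    (N *ᵥ fun x ↦ g (h * x)) = fun x ↦ (N *ᵥ g) (h * x) := by
  ext x
  refine Fintype.sum_equiv (Equiv.mulLeft h) _ _ fun y ↦ ?_
  simp [hN]

open Matrix in
/-- **Gowers' trick**: if every translation-invariant space of functions on `G` that contains a
nonconstant function has dimension at least `k`, then every subset of `G` of cardinality greater
than `|G| / k ^ (1 / 3)` has triple product `G`. -/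
theorem exists_mul_mul_eq_of_le_finrank {G : Type*} [Group G] [Fintype G] (k : ℝ)
    (hk : ∀ W : Submodule ℂ (G → ℂ), (∀ f ∈ W, ∀ h, (fun x ↦ f (h * x)) ∈ W) →
      (∃ f ∈ W, ∃ x y, f x ≠ f y) → k ≤ Module.finrank ℂ W)
    (B : Finset G) (hB : (Fintype.card G : ℝ) ^ 3 < k * (B.card : ℝ) ^ 3) (y : G) :
    ∃ a ∈ B, ∃ b ∈ B, ∃ c ∈ B, a * b * c = y := by
  classical
  by_contra! hy
  set N : ℝ := (Fintype.card G : ℝ) with hN_def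
  set b : ℝ := (B.card : ℝ) with hb_def
  have hN : 0 < N := Nat.cast_pos.2 Fintype.card_pos
  have hb : 0 ≤ b := by positivity
  have hk_pos : 0 < k := by
    by_contra! h
    nlinarith [pow_pos hN 3, pow_nonneg hb 3]
  have hb_pos : 0 < b := by
    refine hb.lt_of_ne fun h ↦ ?_
    rw [← h] at hB
    nlinarith [pow_pos hN 3]
  set β : ℝ := b / N
  have hβN : β * N = b := div_mul_cancel₀ _ hN.ne'
  let χ : G → ℝ := fun x ↦ if x ∈ B then 1 else 0
  have hχ : ∑ x, χ x = b := by simp [χ, hb_def]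
  have hχ_sq : ∀ x, χ x ^ 2 = χ x := fun x ↦ by simp [χ]
  let A : Matrix G G ℂ := of fun x z ↦ ((χ (x⁻¹ * z) - β : ℝ) : ℂ)
  have hA_apply : ∀ x z, A x z = ((χ (x⁻¹ * z) - β : ℝ) : ℂ) := fun x z ↦ rfl
  have hA : ∀ h x z, A (h * x) (h * z) = A x z := fun h x z ↦ by
    rw [hA_apply, hA_apply, _root_.mul_inv_rev, mul_assoc, inv_mul_cancel_left]
  have hA_const : ∀ c : ℂ, (A *ᵥ fun _ ↦ c) = 0 := fun c ↦ by
    ext x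
    simp only [mulVec, dotProduct, ← Finset.sum_mul, hA_apply, ← Complex.ofReal_sum, Pi.zero_apply]
    rw [Fintype.sum_equiv (Equiv.mulLeft x⁻¹) (fun z ↦ χ (x⁻¹ * z) - β) (fun z ↦ χ z - β) fun z ↦ rfl,
      Finset.sum_sub_distrib, hχ, Finset.sum_const, nsmul_eq_mul, Finset.card_univ, mul_comm _ β,
      hβN, sub_self, Complex.ofReal_zero, zero_mul]
  have hA_sum : ∑ x, ∑ z, ‖A x z‖ ^ 2 ≤ N * b := by
    have h : ∀ x, ∑ z, ‖A x z‖ ^ 2 ≤ b := fun x ↦ by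
      simp only [hA_apply, Complex.norm_real, Real.norm_eq_abs, sq_abs]
      rw [Fintype.sum_equiv (Equiv.mulLeft x⁻¹) (fun z ↦ (χ (x⁻¹ * z) - β) ^ 2)
        (fun z ↦ (χ z - β) ^ 2) fun z ↦ rfl]
      have h2 : ∀ z, (χ z - β) ^ 2 = (1 - 2 * β) * χ z + β ^ 2 := fun z ↦ by
        rw [sub_sq, hχ_sq]; ring
      simp only [h2, Finset.sum_add_distrib, ← Finset.mul_sum, hχ, Finset.sum_const, nsmul_eq_mul,
        Finset.card_univ]
      rw [← hN_def, sq, mul_comm N, mul_assoc, hβN]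
      nlinarith [mul_nonneg (div_nonneg hb hN.le : 0 ≤ β) hb]
    calc ∑ x, ∑ z, ‖A x z‖ ^ 2 ≤ ∑ _x : G, b := Finset.sum_le_sum fun x _ ↦ h x
      _ = N * b := by rw [Finset.sum_const, nsmul_eq_mul, Finset.card_univ]
  have hAH : ∀ h x z, (Aᴴ * A) (h * x) (h * z) = (Aᴴ * A) x z := fun h x z ↦ by
    simp only [mul_apply, conjTranspose_apply]
    refine (Fintype.sum_equiv (Equiv.mulLeft h) _ _ fun w ↦ ?_).symm
    simp [hA]
  let g : G → ℂ := fun z ↦ (χ (z⁻¹ * y) : ℂ)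
  have hg_sum : ∑ z, χ (z⁻¹ * y) = b := by
    rw [← hχ]
    exact Fintype.sum_equiv ((Equiv.inv G).trans (Equiv.mulRight y)) _ _ fun z ↦ rfl
  have hg : ∑ z, ‖g z‖ ^ 2 = b := by
    simp only [g, Complex.norm_real, Real.norm_eq_abs, sq_abs, hχ_sq, hg_sum]
  have hAg : ∀ x ∈ B, ‖(A *ᵥ g) x‖ ^ 2 = (β * b) ^ 2 := fun x hx ↦ by
    have h : (A *ᵥ g) x = ((-(β * b) : ℝ) : ℂ) := by
      simp only [mulVec, dotProduct, g, hA_apply, ← Complex.ofReal_mul, ← Complex.ofReal_sum]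
      congr 1
      rw [← hg_sum, Finset.mul_sum, ← Finset.sum_neg_distrib]
      refine Finset.sum_congr rfl fun z _ ↦ ?_
      have h0 : χ (x⁻¹ * z) * χ (z⁻¹ * y) = 0 := by
        simp only [χ]
        by_cases h1 : x⁻¹ * z ∈ B
        · rw [if_neg fun h2 : z⁻¹ * y ∈ B ↦ hy x hx _ h1 _ h2 (by group), mul_zero]
        · rw [if_neg h1, zero_mul]
      rw [sub_mul, h0, zero_sub]
    rw [h, Complex.norm_real, norm_neg, Real.norm_eq_abs, sq_abs]
  have hlower : b * (β * b) ^ 2 ≤ ∑ x, ‖(A *ᵥ g) x‖ ^ 2 := by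
    rw [hb_def, ← nsmul_eq_mul, ← Finset.sum_const, ← Finset.sum_congr rfl hAg]
    exact Finset.sum_le_univ_sum_of_nonneg fun x ↦ by positivity
  have hupper := A.mul_sum_norm_mulVec_sq_le k (fun μ hμ0 hμ ↦ hk _ (fun f hf h ↦ ?_) ?_) g
  · rw [hg] at hupper
    have h1 : k * (b * (β * b) ^ 2) ≤ N * b * b :=
      (mul_le_mul_of_nonneg_left hlower hk_pos.le).trans
        (hupper.trans (mul_le_mul_of_nonneg_right hA_sum hb))
    have h2 : k * b ^ 3 * b ^ 2 ≤ N ^ 3 * b ^ 2 := by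
      calc k * b ^ 3 * b ^ 2 = k * (b * (β * b) ^ 2) * N ^ 2 := by rw [← hβN]; ring
        _ ≤ N * b * b * N ^ 2 := mul_le_mul_of_nonneg_right h1 (by positivity)
        _ = N ^ 3 * b ^ 2 := by ring
    exact absurd (le_of_mul_le_mul_right h2 (by positivity)) (not_le.2 hB)
  · rw [Module.End.mem_eigenspace_iff, toLin'_apply] at hf ⊢
    rw [mulVec_comp_mul_left hAH, hf]
    rfl
  · obtain ⟨u, hu⟩ := hμ.exists_hasEigenvector
    refine ⟨u, hu.1, ?_⟩
    by_contra! hconst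
    have hu' : u = fun _ ↦ u 1 := funext fun x ↦ hconst x 1
    have h := hu.apply_eq_smul
    rw [toLin'_apply, ← mulVec_mulVec, hu', hA_const, mulVec_zero, ← hu'] at h
    exact hu.2 ((smul_eq_zero.1 h.symm).resolve_left hμ0)

/-- Let `G` be simple, `t : V → G` a nontrivial homomorphism, and `W` a translation-invariant space of
functions on `G` containing a nonconstant one. Then some nontrivial character of `V` occurs in `W`,
and so do its twists by the endomorphisms of `V` induced by `G`, so these are at most `dim W`. -/
theorem exists_addChar_card_image_le_finrank {G V α : Type*} [Group G] [IsSimpleGroup G]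
    [AddCommGroup V] [Fintype V] (t : V → G) (t_add : ∀ u v, t (u + v) = t u * t v)
    (ht : ∃ v, t v ≠ 1)
    (W : Submodule ℂ (G → ℂ)) [FiniteDimensional ℂ W]
    (hW : ∀ f ∈ W, ∀ h, (fun x ↦ f (h * x)) ∈ W)
    (hconst : ∃ f ∈ W, ∃ x y, f x ≠ f y)
    (M : α → V →+ V) (S : Finset α) (hM : ∀ a ∈ S, ∃ g, ∀ v, g * t v = t (M a v) * g)
    [DecidableEq (AddChar V ℂ)] :
    ∃ ψ : AddChar V ℂ, ψ ≠ 1 ∧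
      (S.image fun a ↦ ψ.compAddMonoidHom (M a)).card ≤ Module.finrank ℂ W := by
  classical
  have t_zero : t 0 = 1 := by
    have := t_add 0 0
    rwa [add_zero, left_eq_mul] at this
  let K : Subgroup G :=
    { carrier := {h | ∀ f ∈ W, ∀ x, f (h * x) = f x}
      one_mem' := fun f _ x ↦ by rw [one_mul]
      mul_mem' := fun {a b} ha hb f hf x ↦ by rw [mul_assoc, ha f hf, hb f hf]
      inv_mem' := fun {a} ha f hf x ↦ by rw [← ha f hf, mul_inv_cancel_left] }
  have hKn : K.Normal := ⟨fun h hh g f hf x ↦ by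
    have := hh _ (hW f hf g) (g⁻¹ * x)
    simpa [mul_assoc] using this⟩
  have hK : K = ⊥ := by
    refine hKn.eq_bot_or_eq_top.resolve_right fun htop ↦ ?_
    obtain ⟨f, hf, x, y, hxy⟩ := hconst
    have hmem : x * y⁻¹ ∈ K := htop ▸ Subgroup.mem_top _
    exact hxy (by simpa using hmem f hf y)
  obtain ⟨v₀, hv₀⟩ := ht
  have hv₀K : t v₀ ∉ K := by rwa [hK, Subgroup.mem_bot]
  obtain ⟨f, hf, x₀, hx₀⟩ : ∃ f ∈ W, ∃ x, f (t v₀ * x) ≠ f x := by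
    by_contra! h
    exact hv₀K h
  let P : AddChar V ℂ → G → ℂ := fun ψ x ↦ ∑ v, ψ (-v) * f (t v * x)
  have hPW : ∀ ψ, P ψ ∈ W := fun ψ ↦ by
    have : P ψ = ∑ v, ψ (-v) • fun x ↦ f (t v * x) := by
      ext x; simp [P]
    rw [this]
    exact Submodule.sum_mem _ fun v _ ↦ Submodule.smul_mem _ _ (hW f hf _)
  have hPt : ∀ ψ u x, P ψ (t u * x) = ψ u * P ψ x := fun ψ u x ↦ by
    simp only [P, Finset.mul_sum]
    refine Fintype.sum_equiv (Equiv.addRight u) _ _ fun v ↦ ?_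
    simp only [Equiv.coe_addRight, t_add, ← mul_assoc, ← AddChar.map_add_eq_mul]
    congr 2
    abel
  have hPsum : ∀ x, ∑ ψ, P ψ x = Fintype.card V * f x := fun x ↦ by
    simp only [P]
    rw [Finset.sum_comm]
    simp_rw [← Finset.sum_mul, AddChar.sum_apply_eq_ite]
    simp [t_zero]
  obtain ⟨ψ, hψ1, hψ⟩ : ∃ ψ : AddChar V ℂ, ψ ≠ 1 ∧ P ψ ≠ 0 := by
    by_contra! h
    have hP1 : ∀ x, P 1 x = Fintype.card V * f x := fun x ↦ by
      rw [← hPsum, Finset.sum_eq_single 1 (fun ψ _ hψ ↦ by rw [h ψ hψ]; rfl) (by simp)]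
    have h2 := hPt 1 v₀ x₀
    rw [hP1, hP1, AddChar.one_apply, one_mul] at h2
    exact hx₀ (mul_left_cancel₀ (by exact_mod_cast Fintype.card_ne_zero) h2)
  refine ⟨ψ, hψ1, ?_⟩
  set Φ := S.image fun a ↦ ψ.compAddMonoidHom (M a)
  have hΦ : ∀ φ : Φ, ∃ w : W, (w : G → ℂ) ≠ 0 ∧
      ∀ v x, (w : G → ℂ) (t v * x) = φ.1 v * (w : G → ℂ) x := by
    rintro ⟨φ, hφ⟩
    obtain ⟨a, ha, rfl⟩ := Finset.mem_image.1 hφ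
    obtain ⟨g, hg⟩ := hM a ha
    refine ⟨⟨_, hW _ (hPW ψ) g⟩, fun h0 ↦ hψ ?_, fun v x ↦ ?_⟩
    · ext x
      simpa using congrFun h0 (g⁻¹ * x)
    · simp only [← mul_assoc, hg]
      rw [mul_assoc, hPt]
      rfl
  choose w hw0 hwt using hΦ
  have hli : LinearIndependent ℂ w := by
    rw [Fintype.linearIndependent_iff]
    intro c hc φ
    obtain ⟨x, hx⟩ := Function.ne_iff.1 (hw0 φ)
    have hlin := (AddChar.linearIndependent V ℂ).comp (Subtype.val : Φ → AddChar V ℂ)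
      Subtype.val_injective
    rw [Fintype.linearIndependent_iff] at hlin
    have h := hlin (fun φ ↦ c φ * (w φ : G → ℂ) x) (by
      ext v
      have := congrFun (congrArg Subtype.val hc) (t v * x)
      simp only [Submodule.coe_sum, Submodule.coe_smul, Finset.sum_apply, Pi.smul_apply, hwt,
        smul_eq_mul] at this
      simp only [Function.comp_apply, Finset.sum_apply, Pi.smul_apply, smul_eq_mul, Pi.zero_apply]
      exact (Finset.sum_congr rfl fun _ _ ↦ by ring).trans this) φ
    exact (mul_eq_zero.1 h).resolve_right hx
  simpa using hli.fintype_card_le_finrank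

open Matrix in
/-- A nontrivial additive character of `F ^ ι` has at least `|F| ^ |ι| / 4` distinct images under
the linear maps `det A • A`, where `A` is invertible. -/
theorem Matrix.card_pow_le_four_mul_card_image_compAddMonoidHom {ι F : Type*} [Fintype ι]
    [DecidableEq ι] [Field F] [Fintype F] [DecidableEq F] [DecidableEq (AddChar (ι → F) ℂ)]
    {ψ : AddChar (ι → F) ℂ} (hψ : ψ ≠ 1) :
    Fintype.card F ^ Fintype.card ι ≤
      4 * ((Finset.univ.filter fun A : Matrix ι ι F ↦ A.det ≠ 0).image fun A ↦
        ψ.compAddMonoidHom (A.det • A).mulVecLin.toAddMonoidHom).card := by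
  obtain ⟨i, hi⟩ : ∃ i, ∃ x, ψ (Pi.single i x) ≠ 1 := by
    by_contra! h
    refine hψ (DFunLike.ext _ _ fun v ↦ ?_)
    rw [← Finset.univ_sum_single v, AddChar.one_apply]
    refine Finset.sum_induction _ (fun u ↦ ψ u = 1) (fun a b ha hb ↦ ?_) ψ.map_zero_eq_one
      fun i _ ↦ h i _
    rw [AddChar.map_add_eq_mul, ha, hb, one_mul]
  let χ : AddChar F ℂ := ψ.compAddMonoidHom (AddMonoidHom.single (fun _ : ι ↦ F) i)
  have hχ_apply : ∀ x, χ x = ψ (Pi.single i x) := fun x ↦ rfl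
  have hχ : χ.IsPrimitive := AddChar.IsPrimitive.of_ne_one fun h ↦ by
    obtain ⟨x, hx⟩ := hi
    exact hx (by rw [← hχ_apply, h, AddChar.one_apply])
  have hχ_inj : ∀ s t : F, (∀ x, χ (s * x) = χ (t * x)) → s = t := fun s t h ↦
    AddChar.to_mulShift_inj_of_isPrimitive hχ (DFunLike.ext _ _ h)
  let N : (ι → F) → Matrix ι ι F := fun a ↦ 1 + vecMulVec (Pi.single i 1) a
  have hdet : ∀ a, (N a).det = 1 + a i := fun a ↦ by
    simp only [N]
    rw [vecMulVec_eq Unit, det_one_add_replicateCol_mul_replicateRow, dotProduct_single_one]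
  let Ψ : (ι → F) → AddChar (ι → F) ℂ := fun a ↦
    ψ.compAddMonoidHom ((N a).det • N a).mulVecLin.toAddMonoidHom
  have hΨ : ∀ a v, Ψ a v = ψ ((1 + a i) • v) * χ ((1 + a i) * (a ⬝ᵥ v)) := fun a v ↦ by
    change ψ (((N a).det • N a) *ᵥ v) = _
    rw [hdet, hχ_apply, ← AddChar.map_add_eq_mul]
    congr 1
    rw [smul_mulVec]
    simp only [N]
    rw [add_mulVec, one_mulVec, vecMulVec_mulVec, smul_add]
    congr 1
    ext j
    by_cases hj : j = i
    · subst hj; simp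
    · simp [hj]
  have hΨsq : ∀ a b, Ψ a = Ψ b → (1 + a i) * (1 + a i) = (1 + b i) * (1 + b i) := by
    intro a b hab
    have key : ∀ c x, Ψ c (Pi.single i x) = χ ((1 + c i) * (1 + c i) * x) := fun c x ↦ by
      rw [hΨ, dotProduct_single, ← Pi.single_smul', ← hχ_apply, ← AddChar.map_add_eq_mul,
        smul_eq_mul]
      congr 1
      ring
    exact hχ_inj _ _ fun x ↦ by rw [← key, ← key, hab]
  have hΨinj : ∀ a b, 1 + a i ≠ 0 → Ψ a = Ψ b → 1 + a i = 1 + b i → a = b := by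
    intro a b h0 hab hi
    ext j
    refine mul_left_cancel₀ h0 (hχ_inj _ _ fun x ↦ ?_)
    have h := DFunLike.congr_fun hab (Pi.single j x)
    rw [hΨ, hΨ, ← hi, dotProduct_single, dotProduct_single] at h
    rw [mul_assoc, mul_assoc]
    exact mul_left_cancel₀ (ψ.val_isUnit _).ne_zero h
  set T : Finset (ι → F) := Finset.univ.filter fun a ↦ 1 + a i ≠ 0
  have hT : Fintype.card F ^ Fintype.card ι ≤ 2 * T.card := by
    have h1 : Tᶜ.card ≤ T.card := by
      refine Finset.card_le_card_of_injOn (fun a ↦ a + Pi.single i 1) ?_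
        ((add_left_injective _).injOn)
      intro a ha
      have ha : 1 + a i = 0 := by simpa [T] using ha
      simp [T, ← add_assoc, ha]
    have h2 := T.card_add_card_compl
    rw [Fintype.card_fun] at h2
    omega
  have hTimage : T.card ≤ 2 * (T.image Ψ).card := by
    refine Finset.card_le_mul_card_image T 2 fun φ hφ ↦ ?_
    obtain ⟨a, ha, rfl⟩ := Finset.mem_image.1 hφ
    refine (Finset.card_le_card_of_injOn (t := {1 + a i, -(1 + a i)}) (fun b ↦ 1 + b i) ?_ ?_).trans
      Finset.card_le_two
    · intro b hb
      have hb := (Finset.mem_filter.1 hb).2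
      simpa using mul_self_eq_mul_self_iff.1 (hΨsq b a hb)
    · intro b hb c hc hbc
      have hb := Finset.mem_filter.1 hb
      have hc := Finset.mem_filter.1 hc
      exact hΨinj b c (Finset.mem_filter.1 hb.1).2 (hb.2.trans hc.2.symm) hbc
  have hsub : T.image Ψ ⊆ (Finset.univ.filter fun A : Matrix ι ι F ↦ A.det ≠ 0).image fun A ↦
        ψ.compAddMonoidHom (A.det • A).mulVecLin.toAddMonoidHom := by
    intro φ hφ
    obtain ⟨a, ha, rfl⟩ := Finset.mem_image.1 hφ
    refine Finset.mem_image.2 ⟨N a, ?_, rfl⟩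
    simpa [hdet] using (Finset.mem_filter.1 ha).2
  have := Finset.card_le_card hsub
  omega

section

open Matrix

/-- The block matrix `[A, v; 0, d]` of determinant `1`, as an element of `SL(m + 1, F)`. -/
def blockSL {m : ℕ} {F : Type} [Field F] (A : Matrix (Fin m) (Fin m) F) (v : Fin m → F) (d : F)
    (h : A.det * d = 1) : Matrix.SpecialLinearGroup (Fin (m + 1)) F :=
  ⟨(fromBlocks A (replicateCol (Fin 1) v) 0 (d • 1)).submatrix finSumFinEquiv.symm
    finSumFinEquiv.symm, by
      rw [det_submatrix_equiv_self, det_fromBlocks_zero₂₁, det_fin_one]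
      simpa using h⟩

theorem blockSL_mul_blockSL {m : ℕ} {F : Type} [Field F] {A B : Matrix (Fin m) (Fin m) F}
    {u v : Fin m → F} {c d : F} (hA : A.det * c = 1) (hB : B.det * d = 1) :
    blockSL A u c hA * blockSL B v d hB = blockSL (A * B) (A *ᵥ v + d • u) (c * d)
      (by rw [det_mul, mul_mul_mul_comm, hA, hB, one_mul]) := by
  apply Subtype.ext
  change (fromBlocks A (replicateCol (Fin 1) u) 0 (c • 1)).submatrix _ _ *
    (fromBlocks B (replicateCol (Fin 1) v) 0 (d • 1)).submatrix _ _ =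
      (fromBlocks (A * B) (replicateCol (Fin 1) (A *ᵥ v + d • u)) 0 ((c * d) • 1)).submatrix _ _
  rw [submatrix_mul_equiv, fromBlocks_multiply]
  congr 2
  · simp
  · ext i j
    simp [mul_apply, mulVec, dotProduct]
  · simp
  · simp [smul_smul, mul_comm]

theorem eq_zero_of_blockSL_mem_center {m : ℕ} {F : Type} [Field F] {v : Fin m → F}
    {A : Matrix (Fin m) (Fin m) F} {d : F} {h : A.det * d = 1}
    (hv : blockSL A v d h ∈ Subgroup.center (Matrix.SpecialLinearGroup (Fin (m + 1)) F)) :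
    v = 0 := by
  obtain ⟨r, -, hr⟩ := Matrix.SpecialLinearGroup.mem_center_iff.1 hv
  ext i
  have := congrFun (congrFun hr (finSumFinEquiv (Sum.inl i))) (finSumFinEquiv (Sum.inr 0))
  simpa [blockSL, Fin.ext_iff, i.2.ne, diagonal_apply] using this.symm

end

/-- A translation-invariant space of functions on the simple group `PSL(m + 1, q)` which contains a
nonconstant function has dimension at least `q ^ m / 4`. -/
theorem PSL.card_pow_le_four_mul_finrank {m : ℕ} (hm : m ≠ 0) {F : Type} [Field F] [Fintype F]
    [IsSimpleGroup (PSL (m + 1) F)] (W : Submodule ℂ (PSL (m + 1) F → ℂ))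
    [FiniteDimensional ℂ W] (hW : ∀ f ∈ W, ∀ h, (fun x ↦ f (h * x)) ∈ W)
    (hconst : ∃ f ∈ W, ∃ x y, f x ≠ f y) :
    Fintype.card F ^ m ≤ 4 * Module.finrank ℂ W := by
  classical
  let t : (Fin m → F) → PSL (m + 1) F := fun v ↦ QuotientGroup.mk (blockSL 1 v 1 (by simp))
  obtain ⟨ψ, hψ, hcard⟩ := exists_addChar_card_image_le_finrank t
    (fun u v ↦ by
      simp only [t, ← QuotientGroup.mk_mul, blockSL_mul_blockSL]
      simp [add_comm])
    (by
      have : NeZero m := ⟨hm⟩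
      refine ⟨1, fun h ↦ one_ne_zero (α := Fin m → F) ?_⟩
      exact eq_zero_of_blockSL_mem_center ((QuotientGroup.eq_one_iff _).1 h))
    W hW hconst (fun A : Matrix (Fin m) (Fin m) F ↦ (A.det • A).mulVecLin.toAddMonoidHom)
    (Finset.univ.filter fun A ↦ A.det ≠ 0) (fun A hA ↦ by
      have hA : A.det ≠ 0 := (Finset.mem_filter.1 hA).2
      refine ⟨QuotientGroup.mk (blockSL A 0 A.det⁻¹ (mul_inv_cancel₀ hA)), fun v ↦ ?_⟩
      simp only [t, ← QuotientGroup.mk_mul, blockSL_mul_blockSL]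
      simp [smul_smul, inv_mul_cancel₀ hA])
  have h := Matrix.card_pow_le_four_mul_card_image_compAddMonoidHom hψ
  rw [Fintype.card_fin] at h
  omega

/-- **Proposition 2**: if `L = PSL(n, q)` is a nonabelian simple group and `B ⊆ L`
has size at least `2|L|/q^{(n-1)/3}`, then `B³ = L`. -/
theorem statement3 (n q : ℕ) (hn : 2 ≤ n) (F : Type) [Field F] [Fintype F]
    (hq : Fintype.card F = q)
    (hsimple : IsSimpleGroup (PSL n F))
    (hnonabelian : ∃ a b : PSL n F, a * b ≠ b * a)
    (B : Set (PSL n F))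
    (hB : 2 * (Nat.card (PSL n F) : ℝ) / (q : ℝ) ^ (((n : ℝ) - 1) / 3) ≤ Nat.card B) :
    B * B * B = (Set.univ : Set (PSL n F)) := by
  classical
  obtain ⟨m, rfl⟩ : ∃ m, n = m + 1 := ⟨n - 1, by omega⟩
  have hq0 : (0 : ℝ) < q := by
    rw [← hq]
    exact Nat.cast_pos.2 Fintype.card_pos
  have : Fintype (PSL (m + 1) F) := Fintype.ofFinite _
  have hcube : ((q : ℝ) ^ (((m + 1 : ℕ) - 1 : ℝ) / 3)) ^ 3 = (q : ℝ) ^ m := by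
    rw [← Real.rpow_natCast, ← Real.rpow_mul hq0.le, ← Real.rpow_natCast]
    congr 1
    push_cast
    ring
  set r : ℝ := (q : ℝ) ^ (((m + 1 : ℕ) - 1 : ℝ) / 3)
  have hr : 0 < r := Real.rpow_pos_of_pos hq0 _
  have hN : (0 : ℝ) < Fintype.card (PSL (m + 1) F) := Nat.cast_pos.2 Fintype.card_pos
  rw [div_le_iff₀ hr, Nat.card_eq_fintype_card, Nat.card_eq_fintype_card, ← Set.toFinset_card]
    at hB
  have hB_cube := pow_le_pow_left₀ (by positivity) hB 3
  rw [mul_pow, mul_pow, hcube] at hB_cube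
  refine Set.eq_univ_of_forall fun y ↦ ?_
  obtain ⟨a, ha, b, hb, c, hc, rfl⟩ := exists_mul_mul_eq_of_le_finrank ((q : ℝ) ^ m / 4)
    (fun W hW hconst ↦ by
      have h := PSL.card_pow_le_four_mul_finrank (by omega) W hW hconst
      rw [hq] at h
      rw [div_le_iff₀' (by norm_num)]
      exact_mod_cast h)
    B.toFinset (by nlinarith [pow_pos hN 3]) y
  exact Set.mul_mem_mul (Set.mul_mem_mul (Set.mem_toFinset.1 ha) (Set.mem_toFinset.1 hb))
    (Set.mem_toFinset.1 hc)
end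

section
/- There is an absolute constant C such that the following holds. Let F be a finite field of cardinality q, let E be a field extension of F of degree n, and let i : SL(4, E) → SL(4n, F)-conjugacy be the restriction-of-scalars map sending g ∈ SL(4, E) to g regarded (via a choice of F-basis of E⁴) as an F-linear automorphism of the 4n-dimensional F-vector space E⁴. Then the number of elements g ∈ SL(4, E) such that i(g) is not regular semisimple (i.e., the characteristic polynomial over F of the F-linear map i(g) is not squarefree) is at most C·n·q^{−n/2}·|SL(4, E)|. -/
/-- The restriction-of-scalars map: an element `g ∈ SL(4, E)` regarded as an `F`-linear
automorphism of the `4n`-dimensional `F`-vector space `E⁴` (where `n = [E : F]`). -/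
noncomputable def restrictScalarsEmbedding (F E : Type) [Field F] [Field E] [Algebra F E]
    (g : Matrix.SpecialLinearGroup (Fin 4) E) : (Fin 4 → E) →ₗ[F] (Fin 4 → E) :=
  LinearMap.restrictScalars F (Matrix.toLin' (g : Matrix (Fin 4) (Fin 4) E))

open Polynomial Matrix

theorem charpoly_dvd_of_aeval_eq_zero {K : Type*} [Field K] {m : ℕ}
    {g : Matrix (Fin m) (Fin m) K} {v : Fin m → K}
    (hv : LinearIndependent K (fun i : Fin m => (g ^ (i : ℕ)) *ᵥ v))
    {p : K[X]} (hp : aeval g p = 0) : g.charpoly ∣ p := by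
  have hmon := g.charpoly_monic
  rw [← modByMonic_eq_zero_iff_dvd hmon]
  set r := p %ₘ g.charpoly with hr
  have hr0 : aeval g r = 0 := by
    have h := congrArg (aeval g) (modByMonic_add_div p g.charpoly)
    rw [map_add, map_mul, aeval_self_charpoly, zero_mul, add_zero, hp] at h
    exact h
  have hdeg : r.degree < m := by
    have h := degree_modByMonic_lt p hmon
    rwa [charpoly_degree_eq_dim, Fintype.card_fin] at h
  have hsum : ∑ i : Fin m, r.coeff i • ((g ^ (i : ℕ)) *ᵥ v) = 0 := by
    have hm : r.coeff m = 0 := coeff_eq_zero_of_degree_lt hdeg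
    have hlt : r.natDegree < m + 1 := by
      rw [Nat.lt_succ_iff, natDegree_le_iff_degree_le]
      exact hdeg.le
    rw [aeval_eq_sum_range' hlt, Finset.sum_range_succ, hm, zero_smul, add_zero,
      ← Fin.sum_univ_eq_sum_range (fun i => r.coeff i • g ^ i)] at hr0
    have h := congrArg (fun A => A *ᵥ v) hr0
    simpa [Matrix.sum_mulVec, Matrix.smul_mulVec] using h
  have hc := Fintype.linearIndependent_iff.1 hv _ hsum
  ext i
  by_cases hi : i < m
  · simpa using hc ⟨i, hi⟩
  · rw [coeff_zero]
    exact coeff_eq_zero_of_degree_lt (hdeg.trans_le (by exact_mod_cast not_lt.1 hi))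

theorem isCoprime_map_frobenius_pow {F E : Type*} [Field F] [Field E] [Algebra F E] [Fintype F]
    [Finite E] (P : E[X])
    (h : ∀ d, 1 ≤ d → d ≤ Module.finrank F E / 2 →
      IsCoprime P (P.map ((FiniteField.frobeniusAlgHom F E ^ d : E →ₐ[F] E) : E →+* E))) :
    Pairwise (Function.onFun IsCoprime fun i : Fin (Module.finrank F E) =>
      P.map ((FiniteField.frobeniusAlgHom F E ^ (i : ℕ) : E →ₐ[F] E) : E →+* E)) := by
  set φ := FiniteField.frobeniusAlgHom F E with hφ
  have hmap : ∀ a b : ℕ, (P.map ((φ ^ a : E →ₐ[F] E) : E →+* E)).map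
      ((φ ^ b : E →ₐ[F] E) : E →+* E) = P.map ((φ ^ (a + b) : E →ₐ[F] E) : E →+* E) := by
    intro a b
    rw [Polynomial.map_map, add_comm, pow_add]
    rfl
  have hn : φ ^ Module.finrank F E = 1 := by
    rw [← FiniteField.orderOf_frobeniusAlgHom F E]
    exact pow_orderOf_eq_one _
  have key : ∀ d, 1 ≤ d → d < Module.finrank F E →
      IsCoprime P (P.map ((φ ^ d : E →ₐ[F] E) : E →+* E)) := by
    intro d h1 h2
    by_cases hd : d ≤ Module.finrank F E / 2
    · exact h d h1 hd
    · have h3 := (h (Module.finrank F E - d) (by omega) (by omega)).map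
        (Polynomial.mapRingHom ((φ ^ d : E →ₐ[F] E) : E →+* E))
      rw [coe_mapRingHom, hmap, Nat.sub_add_cancel h2.le, hn] at h3
      have h4 : P.map ((1 : E →ₐ[F] E) : E →+* E) = P := Polynomial.map_id
      rw [h4] at h3
      exact h3.symm
  have main : ∀ i j : Fin (Module.finrank F E), i < j →
      IsCoprime (P.map ((φ ^ (i : ℕ) : E →ₐ[F] E) : E →+* E))
        (P.map ((φ ^ (j : ℕ) : E →ₐ[F] E) : E →+* E)) := by
    intro i j hij
    have h3 := (key (j - i) (by omega) (by omega)).map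
        (Polynomial.mapRingHom ((φ ^ (i : ℕ) : E →ₐ[F] E) : E →+* E))
    rwa [coe_mapRingHom, hmap, Nat.sub_add_cancel (by omega)] at h3
  intro i j hij
  rcases lt_or_gt_of_ne hij with h' | h'
  · exact main i j h'
  · exact (main j i h').symm

theorem squarefree_charpoly_restrictScalars {F E : Type*} [Field F] [Field E] [Algebra F E]
    [Fintype F] [FiniteDimensional F E] {m : ℕ} {g : Matrix (Fin m) (Fin m) E} {v : Fin m → E}
    (hv : LinearIndependent E (fun i : Fin m => (g ^ (i : ℕ)) *ᵥ v))
    (hsep : g.charpoly.Separable)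
    (h : ∀ d, 1 ≤ d → d ≤ Module.finrank F E / 2 →
      IsCoprime g.charpoly (g.charpoly.map
        ((FiniteField.frobeniusAlgHom F E ^ d : E →ₐ[F] E) : E →+* E))) :
    Squarefree ((Matrix.toLin' g).restrictScalars F).charpoly := by
  have : Finite E := Module.finite_of_finite F
  set T := (Matrix.toLin' g).restrictScalars F with hT
  set χ := T.charpoly with hχ
  have hco := isCoprime_map_frobenius_pow g.charpoly h
  have hann : aeval g χ = 0 := by
    have h1 : ∀ p : F[X], aeval T p = (Matrix.toLin' (aeval g p)).restrictScalars F := by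
      intro p
      induction p using Polynomial.induction_on' with
      | add p q hp hq => simp [hp, hq]
      | monomial k a =>
        rw [aeval_monomial, aeval_monomial]
        have : ∀ k : ℕ, T ^ k = (Matrix.toLin' (g ^ k)).restrictScalars F := by
          intro k
          induction k with
          | zero => ext; simp
          | succ k ih => rw [pow_succ, ih, pow_succ, Matrix.toLin'_mul, hT]; rfl
        rw [this, ← Algebra.smul_def, ← Algebra.smul_def]
        refine LinearMap.ext fun x => ?_
        change a • ((g ^ k) *ᵥ x) = (a • g ^ k) *ᵥ x
        rw [smul_mulVec]
    have h2 := h1 χ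
    rw [hχ, LinearMap.aeval_self_charpoly] at h2
    have h3 : Matrix.toLin' (aeval g χ) = 0 := by
      ext x i
      have := congrArg (fun f => f (Pi.single x 1) i) h2
      simpa using this.symm
    simpa using h3
  have hdvd : g.charpoly ∣ χ.map (algebraMap F E) := by
    apply charpoly_dvd_of_aeval_eq_zero hv
    rw [aeval_map_algebraMap, hann]
  have hall : ∀ i : Fin (Module.finrank F E),
      g.charpoly.map ((FiniteField.frobeniusAlgHom F E ^ (i : ℕ) : E →ₐ[F] E) : E →+* E) ∣
        χ.map (algebraMap F E) := by
    intro i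
    have h1 := Polynomial.map_dvd
      ((FiniteField.frobeniusAlgHom F E ^ (i : ℕ) : E →ₐ[F] E) : E →+* E) hdvd
    rwa [Polynomial.map_map, AlgHom.comp_algebraMap] at h1
  have hprod := Fintype.prod_dvd_of_coprime hco hall
  have hmon : (∏ i : Fin (Module.finrank F E), g.charpoly.map
      ((FiniteField.frobeniusAlgHom F E ^ (i : ℕ) : E →ₐ[F] E) : E →+* E)).Monic :=
    monic_prod_of_monic _ _ fun i _ => g.charpoly_monic.map _
  have heq : ∏ i : Fin (Module.finrank F E), g.charpoly.map
      ((FiniteField.frobeniusAlgHom F E ^ (i : ℕ) : E →ₐ[F] E) : E →+* E) =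
        χ.map (algebraMap F E) := by
    refine (eq_of_monic_of_dvd_of_natDegree_le hmon (T.charpoly_monic.map _) hprod ?_).symm
    rw [natDegree_map, LinearMap.charpoly_natDegree,
      natDegree_prod_of_monic _ _ fun i _ => g.charpoly_monic.map _]
    simp only [natDegree_map, charpoly_natDegree_eq_dim, Finset.sum_const, Finset.card_univ,
      Fintype.card_fin]
    rw [← Module.finrank_mul_finrank F E (Fin m → E)]
    simp
  have hs : (χ.map (algebraMap F E)).Separable :=
    heq ▸ separable_prod hco fun i => hsep.map
  exact ((separable_map _).1 hs).squarefree

theorem card_commonRoot_frobenius_le {E : Type*} [Field E] (L : Type*) [Field L]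
    [Algebra E L] (a b : E) {s : ℕ} (hs : 2 ≤ s) :
    {c : E | ∃ x : L, aeval x (X ^ 4 + C a * X ^ 3 + C b * X ^ 2 + C c * X + 1 : E[X]) = 0 ∧
      aeval x (X ^ 4 + C (a ^ s) * X ^ 3 + C (b ^ s) * X ^ 2 + C (c ^ s) * X + 1 : E[X]) = 0}.ncard
      ≤ 4 * s := by
  classical
  set f : L[X] := X ^ 4 + C (algebraMap E L a) * X ^ 3 + C (algebraMap E L b) * X ^ 2 + 1 with hf
  set f' : L[X] := X ^ 4 + C (algebraMap E L (a ^ s)) * X ^ 3 +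
    C (algebraMap E L (b ^ s)) * X ^ 2 + 1 with hf'
  have hfd : f.natDegree = 4 := by rw [hf]; compute_degree!
  have hfd' : f'.natDegree = 4 := by rw [hf']; compute_degree!
  set h : L[X] := (-f) ^ s + X ^ (s - 1) * f' with hh
  have hlt : (X ^ (s - 1) * f').natDegree < ((-f) ^ s).natDegree := by
    refine (natDegree_mul_le).trans_lt ?_
    rw [natDegree_X_pow, natDegree_pow, natDegree_neg, hfd, hfd']
    omega
  have hdeg : h.natDegree = 4 * s := by
    rw [hh, natDegree_add_eq_left_of_natDegree_lt hlt, natDegree_pow, natDegree_neg, hfd, mul_comm]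
  have h0 : h ≠ 0 := by
    intro h0
    rw [h0, natDegree_zero] at hdeg
    omega
  have hsub : algebraMap E L '' {c : E | ∃ x : L,
      aeval x (X ^ 4 + C a * X ^ 3 + C b * X ^ 2 + C c * X + 1 : E[X]) = 0 ∧
      aeval x (X ^ 4 + C (a ^ s) * X ^ 3 + C (b ^ s) * X ^ 2 + C (c ^ s) * X + 1 : E[X]) = 0} ⊆
      ((h.roots.toFinset.image fun x => -f.eval x / x : Finset L) : Set L) := by
    rintro _ ⟨c, ⟨x, h1, h2⟩, rfl⟩
    have hx : x ≠ 0 := by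
      rintro rfl
      simp at h1
    simp only [map_add, map_mul, map_pow, aeval_X, aeval_C, map_one] at h1 h2
    have e1 : -f.eval x = algebraMap E L c * x := by
      simp only [hf, eval_add, eval_mul, eval_pow, eval_X, eval_C, eval_one]
      linear_combination -h1
    have e2 : f'.eval x = - ((algebraMap E L c) ^ s * x) := by
      simp only [hf', eval_add, eval_mul, eval_pow, eval_X, eval_C, eval_one, map_pow]
      linear_combination h2
    rw [Finset.mem_coe, Finset.mem_image]
    refine ⟨x, ?_, ?_⟩
    · rw [Multiset.mem_toFinset, mem_roots h0, IsRoot.def, hh, eval_add, eval_pow, eval_neg, e1,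
        eval_mul, eval_pow, eval_X, e2]
      obtain ⟨k, rfl⟩ : ∃ k, s = k + 1 := ⟨s - 1, by omega⟩
      rw [Nat.add_sub_cancel]
      ring
    · rw [e1, mul_div_cancel_right₀ _ hx]
  rw [← Set.ncard_image_of_injective _ (algebraMap E L).injective]
  refine (Set.ncard_le_ncard hsub (Finset.finite_toSet _)).trans ?_
  rw [Set.ncard_coe_finset]
  refine Finset.card_image_le.trans ((Multiset.toFinset_card_le _).trans ?_)
  exact (card_roots' h).trans hdeg.le

theorem card_multipleRoot_le {E : Type*} [Field E] (L : Type*) [Field L]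
    [Algebra E L] (a b : E) :
    {c : E | ∃ x : L, aeval x (X ^ 4 + C a * X ^ 3 + C b * X ^ 2 + C c * X + 1 : E[X]) = 0 ∧
      aeval x (derivative (X ^ 4 + C a * X ^ 3 + C b * X ^ 2 + C c * X + 1 : E[X])) = 0}.ncard
      ≤ 4 := by
  classical
  set f : L[X] := X ^ 4 + C (algebraMap E L a) * X ^ 3 + C (algebraMap E L b) * X ^ 2 + 1 with hf
  set h : L[X] := f - X * derivative f with hh
  have hdeg : h.natDegree ≤ 4 := by
    rw [hh, hf]
    simp only [derivative_add, derivative_mul, derivative_C, derivative_X_pow, derivative_one]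
    compute_degree
  have h0 : h ≠ 0 := by
    intro h0
    have := congrArg (eval 0) h0
    simp [hh, hf] at this
  have hsub : algebraMap E L '' {c : E | ∃ x : L,
      aeval x (X ^ 4 + C a * X ^ 3 + C b * X ^ 2 + C c * X + 1 : E[X]) = 0 ∧
      aeval x (derivative (X ^ 4 + C a * X ^ 3 + C b * X ^ 2 + C c * X + 1 : E[X])) = 0} ⊆
      ((h.roots.toFinset.image fun x => -f.eval x / x : Finset L) : Set L) := by
    rintro _ ⟨c, ⟨x, h1, h2⟩, rfl⟩
    have hx : x ≠ 0 := by
      rintro rfl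
      simp at h1
    simp only [derivative_mul, derivative_C, derivative_X_pow, derivative_one,
      derivative_X, map_add, map_mul, map_pow, aeval_X, aeval_C, map_one, map_zero,
      Nat.cast_ofNat, map_ofNat] at h1 h2
    have e1 : -f.eval x = algebraMap E L c * x := by
      simp only [hf, eval_add, eval_mul, eval_pow, eval_X, eval_C, eval_one]
      linear_combination -h1
    rw [Finset.mem_coe, Finset.mem_image]
    refine ⟨x, ?_, ?_⟩
    · rw [Multiset.mem_toFinset, mem_roots h0, IsRoot.def, hh, hf]
      simp only [derivative_add, derivative_mul, derivative_C, derivative_X_pow, derivative_one,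
        eval_add, eval_sub, eval_mul, eval_pow, eval_X, eval_C, eval_one, eval_zero]
      linear_combination h1 - x * h2
    · rw [e1, mul_div_cancel_right₀ _ hx]
  rw [← Set.ncard_image_of_injective _ (algebraMap E L).injective]
  refine (Set.ncard_le_ncard hsub (Finset.finite_toSet _)).trans ?_
  rw [Set.ncard_coe_finset]
  refine Finset.card_image_le.trans ((Multiset.toFinset_card_le _).trans ?_)
  exact (card_roots' h).trans hdeg

theorem card_pow_le_card_SL_four (E : Type*) [Field E] [Finite E] :
    Nat.card E ^ 15 ≤ 16 * Nat.card (SpecialLinearGroup (Fin 4) E) := by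
  classical
  have := Fintype.ofFinite E
  set Q := Nat.card E with hQ
  have hQ2 : 2 ≤ Q := Finite.one_lt_card
  have h1 : Nat.card (GL (Fin 4) E) ≤ Nat.card (SpecialLinearGroup (Fin 4) E) * Q := by
    rw [hQ, ← Nat.card_prod]
    let D : GL (Fin 4) E → Matrix (Fin 4) (Fin 4) E := fun g =>
      diagonal (fun i => if i = 0 then (g.det : E)⁻¹ else 1)
    have hD : ∀ g : GL (Fin 4) E, (D g * (g : Matrix (Fin 4) (Fin 4) E)).det = 1 := by
      intro g
      simp only [D]
      rw [det_mul, det_diagonal, Finset.prod_ite_eq' Finset.univ (0 : Fin 4) (fun _ => _)]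
      simp only [Finset.mem_univ, if_true, GeneralLinearGroup.val_det_apply]
      exact inv_mul_cancel₀ ((isUnit_iff_isUnit_det _).1 g.isUnit).ne_zero
    refine Nat.card_le_card_of_injective
      (fun g => ((⟨D g * g, hD g⟩ : SpecialLinearGroup (Fin 4) E), (g.det : E))) ?_
    intro g₁ g₂ h
    have h1 : D g₁ * g₁ = D g₂ * g₂ := congrArg (fun p => p.1.1) h
    have h2 : (g₁.det : E) = g₂.det := congrArg Prod.snd h
    have hDD : D g₁ = D g₂ := by simp only [D, h2]
    rw [hDD] at h1
    have hu : IsUnit (D g₂) := by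
      rw [isUnit_iff_isUnit_det]
      exact isUnit_of_mul_isUnit_left (by rw [← det_mul, hD]; exact isUnit_one)
    exact Units.ext (hu.mul_left_cancel h1)
  rw [card_GL_field] at h1
  have h2 : Q ^ 16 ≤ 16 * ∏ i : Fin 4, (Fintype.card E ^ 4 - Fintype.card E ^ (i : ℕ)) := by
    have h3 : ∀ i : Fin 4, Q ^ 4 ≤ 2 * (Q ^ 4 - Q ^ (i : ℕ)) := by
      intro i
      have : 2 * Q ^ (i : ℕ) ≤ Q ^ 4 :=
        (Nat.mul_le_mul_right _ hQ2).trans (by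
          rw [← pow_succ']
          exact Nat.pow_le_pow_right (by omega) (by omega))
      omega
    have h4 := Finset.prod_le_prod' (s := Finset.univ) fun i _ => h3 i
    rw [Finset.prod_mul_distrib] at h4
    simp only [Finset.prod_const, Finset.card_univ, Fintype.card_fin, ← pow_mul] at h4
    rw [← Nat.card_eq_fintype_card, ← hQ]
    exact h4
  refine Nat.le_of_mul_le_mul_right (c := Q) ?_ (by omega)
  calc Q ^ 15 * Q = Q ^ 16 := by ring
    _ ≤ _ := h2
    _ ≤ 16 * (Nat.card (SpecialLinearGroup (Fin 4) E) * Q) := Nat.mul_le_mul_left _ h1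
    _ = _ := by ring

theorem exists_dual_of_linearIndependent {K : Type*} [Field K] {m k : ℕ} (hk : k + 1 < m)
    {b : Fin (k + 1) → Fin m → K} (hb : LinearIndependent K b) :
    ∃ φ w : Fin m → K, φ ⬝ᵥ w = 0 ∧ (∀ i : Fin k, φ ⬝ᵥ b i.castSucc = 0) ∧
      φ ⬝ᵥ b (Fin.last k) = 1 ∧ w ∉ Submodule.span K (Set.range b) := by
  have hlast := (linearIndependent_finSucc'.1 hb).2
  obtain ⟨f, hf, hker⟩ := Submodule.exists_le_ker_of_notMem hlast
  obtain ⟨φ, rfl⟩ := (dotProductEquiv K (Fin m)).surjective f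
  rw [dotProductEquiv_apply_apply] at hf
  have hW : Submodule.span K (Set.range b) ≠ ⊤ := by
    intro h
    have h1 := finrank_span_eq_card hb
    rw [h, finrank_top, Module.finrank_fin_fun, Fintype.card_fin] at h1
    omega
  obtain ⟨w, -, hw⟩ := SetLike.exists_of_lt hW.lt_top
  have hl : (φ ⬝ᵥ b (Fin.last k))⁻¹ * (φ ⬝ᵥ b (Fin.last k)) = 1 := inv_mul_cancel₀ hf
  refine ⟨(φ ⬝ᵥ b (Fin.last k))⁻¹ • φ,
    w - ((φ ⬝ᵥ b (Fin.last k))⁻¹ * φ ⬝ᵥ w) • b (Fin.last k), ?_, fun i => ?_, ?_, ?_⟩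
  · rw [dotProduct_sub, smul_dotProduct, smul_dotProduct, dotProduct_smul, smul_eq_mul,
      smul_eq_mul, smul_eq_mul]
    linear_combination -((φ ⬝ᵥ b (Fin.last k))⁻¹ * φ ⬝ᵥ w) * hl
  · have h1 : b i.castSucc ∈ LinearMap.ker (dotProductEquiv K (Fin m) φ) :=
      hker (Submodule.subset_span ⟨i, rfl⟩)
    rw [LinearMap.mem_ker, dotProductEquiv_apply_apply] at h1
    rw [smul_dotProduct, h1, smul_zero]
  · rw [smul_dotProduct, smul_eq_mul, hl]
  · intro h
    apply hw
    have h2 := Submodule.add_mem _ h (Submodule.smul_mem _ ((φ ⬝ᵥ b (Fin.last k))⁻¹ * φ ⬝ᵥ w)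
      (Submodule.subset_span ⟨Fin.last k, rfl⟩ : b (Fin.last k) ∈ Submodule.span K (Set.range b)))
    rwa [sub_add_cancel] at h2

theorem mulVec_notMem_span_krylov {K : Type*} [Field K] {m k : ℕ}
    {g : Matrix (Fin m) (Fin m) K} (hg : IsUnit g) {v w : Fin m → K}
    (hk : (g ^ k) *ᵥ v ∈
      Submodule.span K (Set.range fun i : Fin k => (g ^ (i : ℕ)) *ᵥ v))
    (hw : w ∉ Submodule.span K (Set.range fun i : Fin k => (g ^ (i : ℕ)) *ᵥ v)) :
    g *ᵥ w ∉ Submodule.span K (Set.range fun i : Fin k => (g ^ (i : ℕ)) *ᵥ v) := by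
  set W := Submodule.span K (Set.range fun i : Fin k => (g ^ (i : ℕ)) *ᵥ v) with hW
  have hinj : Function.Injective (Matrix.toLin' g) := Matrix.mulVec_injective_iff_isUnit.2 hg
  have hle : W.map (Matrix.toLin' g) ≤ W := by
    rw [hW, Submodule.map_span_le]
    rintro _ ⟨i, rfl⟩
    rw [toLin'_apply, mulVec_mulVec, ← pow_succ']
    rcases (Nat.succ_le_of_lt i.2).lt_or_eq with h | h
    · exact Submodule.subset_span ⟨⟨i + 1, h⟩, rfl⟩
    · rw [← Nat.succ_eq_add_one, h]
      exact hk
  have heq : W.map (Matrix.toLin' g) = W :=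
    Submodule.eq_of_le_of_finrank_eq hle (LinearEquiv.finrank_eq (Submodule.equivMapOfInjective _ hinj W)).symm
  intro h
  rw [← heq] at h
  obtain ⟨y, hy, hyw⟩ := h
  exact hw (hinj hyw ▸ hy)

theorem card_linearDependent_krylov_mul_le {K : Type*} [Field K] [Finite K] {m k : ℕ}
    (hk : k + 1 < m) (v : Fin m → K) :
    {g : SpecialLinearGroup (Fin m) K |
      LinearIndependent K (fun i : Fin (k + 1) => ((g : Matrix (Fin m) (Fin m) K) ^ (i : ℕ)) *ᵥ v) ∧
      ¬ LinearIndependent K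
        (fun i : Fin (k + 2) => ((g : Matrix (Fin m) (Fin m) K) ^ (i : ℕ)) *ᵥ v)}.ncard *
      Nat.card K ≤ Nat.card (SpecialLinearGroup (Fin m) K) := by
  set N := {g : SpecialLinearGroup (Fin m) K |
      LinearIndependent K (fun i : Fin (k + 1) => ((g : Matrix (Fin m) (Fin m) K) ^ (i : ℕ)) *ᵥ v) ∧
      ¬ LinearIndependent K
        (fun i : Fin (k + 2) => ((g : Matrix (Fin m) (Fin m) K) ^ (i : ℕ)) *ᵥ v)} with hN
  have hex : ∀ b : Fin (k + 1) → Fin m → K, ∃ φ w : Fin m → K, φ ⬝ᵥ w = 0 ∧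
      (LinearIndependent K b → (∀ i : Fin k, φ ⬝ᵥ b i.castSucc = 0) ∧
      φ ⬝ᵥ b (Fin.last k) = 1 ∧ w ∉ Submodule.span K (Set.range b)) := by
    intro b
    by_cases hb : LinearIndependent K b
    · obtain ⟨φ, w, h1, h2⟩ := exists_dual_of_linearIndependent hk hb
      exact ⟨φ, w, h1, fun _ => h2⟩
    · exact ⟨0, 0, by simp, fun h => absurd h hb⟩
  choose φ w hφw hφ using hex
  let B : SpecialLinearGroup (Fin m) K → Fin (k + 1) → Fin m → K :=
    fun g i => ((g : Matrix (Fin m) (Fin m) K) ^ (i : ℕ)) *ᵥ v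
  let H : (Fin (k + 1) → Fin m → K) → K → SpecialLinearGroup (Fin m) K := fun b t =>
    ⟨1 + vecMulVec (t • w b) (φ b), by
      rw [vecMulVec_eq Unit, det_one_add_replicateCol_mul_replicateRow, dotProduct_smul, hφw,
        smul_zero, add_zero]⟩
  have hH : ∀ b t x, (H b t : Matrix (Fin m) (Fin m) K) *ᵥ x = x + (t * (φ b ⬝ᵥ x)) • w b := by
    intro b t x
    change (1 + vecMulVec (t • w b) (φ b)) *ᵥ x = _
    rw [add_mulVec, one_mulVec, vecMulVec_mulVec]
    ext i
    simp
    ring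
  have hmul : ∀ (g h : SpecialLinearGroup (Fin m) K) (x : Fin m → K),
      ((g * h : SpecialLinearGroup (Fin m) K) : Matrix (Fin m) (Fin m) K) *ᵥ x =
        (g : Matrix (Fin m) (Fin m) K) *ᵥ ((h : Matrix (Fin m) (Fin m) K) *ᵥ x) := by
    intro g h x
    exact (mulVec_mulVec _ _ _).symm
  have hB : ∀ g ∈ N, ∀ t, B (g * H (B g) t) = B g := by
    intro g hg t
    have h1 : ∀ i, i ≤ k → ((g * H (B g) t : SpecialLinearGroup (Fin m) K) :
        Matrix (Fin m) (Fin m) K) ^ i *ᵥ v = (g : Matrix (Fin m) (Fin m) K) ^ i *ᵥ v := by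
      intro i
      induction i with
      | zero => simp
      | succ i ih =>
        intro hi
        rw [pow_succ', ← mulVec_mulVec, ih (by omega), hmul, hH]
        have h2 : φ (B g) ⬝ᵥ ((g : Matrix (Fin m) (Fin m) K) ^ i *ᵥ v) = 0 :=
          (hφ (B g) hg.1).1 ⟨i, by omega⟩
        rw [h2, mul_zero, zero_smul, add_zero, mulVec_mulVec, ← pow_succ']
    funext i
    exact h1 i (by omega)
  have hmem : ∀ g ∈ N, (g : Matrix (Fin m) (Fin m) K) ^ (k + 1) *ᵥ v ∈
      Submodule.span K (Set.range (B g)) := by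
    intro g hg
    by_contra h
    exact hg.2 (linearIndependent_finSucc'.2 ⟨hg.1, h⟩)
  rw [← Nat.card_coe_set_eq, ← Nat.card_prod]
  refine Nat.card_le_card_of_injective (fun p : N × K => (p.1 : SpecialLinearGroup (Fin m) K) *
    H (B p.1) p.2) ?_
  rintro ⟨⟨g₁, hg₁⟩, t₁⟩ ⟨⟨g₂, hg₂⟩, t₂⟩ h
  dsimp only at h
  have hb : B g₁ = B g₂ := by rw [← hB g₁ hg₁ t₁, h, hB g₂ hg₂ t₂]
  have hb' : ∀ g ∈ N, ∀ t, ((g * H (B g) t : SpecialLinearGroup (Fin m) K) :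
      Matrix (Fin m) (Fin m) K) *ᵥ (B g (Fin.last k)) =
        (g : Matrix (Fin m) (Fin m) K) ^ (k + 1) *ᵥ v +
          t • ((g : Matrix (Fin m) (Fin m) K) *ᵥ w (B g)) := by
    intro g hg t
    rw [hmul, hH, (hφ (B g) hg.1).2.1, mul_one, mulVec_add,
      mulVec_smul, pow_succ', ← mulVec_mulVec]
    rfl
  have hw' : ∀ g ∈ N, ∀ t, ((g * H (B g) t : SpecialLinearGroup (Fin m) K) :
      Matrix (Fin m) (Fin m) K) *ᵥ w (B g) = (g : Matrix (Fin m) (Fin m) K) *ᵥ w (B g) := by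
    intro g hg t
    rw [hmul, hH, hφw, mul_zero, zero_smul, add_zero]
  have ht : t₁ = t₂ := by
    by_contra hne
    have e1 := hb' g₁ hg₁ t₁
    have e2 := hb' g₂ hg₂ t₂
    have e3 := hw' g₁ hg₁ t₁
    have e4 := hw' g₂ hg₂ t₂
    rw [h, hb] at e1 e3
    rw [e2] at e1
    rw [e4] at e3
    rw [← e3] at e1
    have e5 : (t₁ - t₂) • ((g₂ : Matrix (Fin m) (Fin m) K) *ᵥ w (B g₂)) =
        (g₂ : Matrix (Fin m) (Fin m) K) ^ (k + 1) *ᵥ v -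
          (g₁ : Matrix (Fin m) (Fin m) K) ^ (k + 1) *ᵥ v := by
      rw [sub_smul, sub_eq_sub_iff_add_eq_add, e1, add_comm]
    have e6 : (t₁ - t₂) • ((g₂ : Matrix (Fin m) (Fin m) K) *ᵥ w (B g₂)) ∈
        Submodule.span K (Set.range (B g₂)) := by
      rw [e5]
      exact Submodule.sub_mem _ (hmem g₂ hg₂) (hb ▸ hmem g₁ hg₁)
    rw [Submodule.smul_mem_iff _ (sub_ne_zero.2 hne)] at e6
    refine mulVec_notMem_span_krylov ?_ (hmem g₂ hg₂) (hφ (B g₂) hg₂.1).2.2 e6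
    rw [isUnit_iff_isUnit_det, g₂.det_coe]
    exact isUnit_one
  subst ht
  rw [hb] at h
  have hg : g₁ = g₂ := mul_right_cancel h
  subst hg
  rfl

theorem eq_of_charpoly_eq_of_krylov_eq {K : Type*} [Field K] {m : ℕ}
    {g h : Matrix (Fin m) (Fin m) K} {v : Fin m → K}
    (hv : LinearIndependent K (fun i : Fin m => (g ^ (i : ℕ)) *ᵥ v))
    (hP : g.charpoly = h.charpoly) (hk : ∀ i < m, (g ^ i) *ᵥ v = (h ^ i) *ᵥ v) : g = h := by
  have hCH : ∀ A : Matrix (Fin m) (Fin m) K,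
      A ^ m *ᵥ v = -∑ i ∈ Finset.range m, A.charpoly.coeff i • (A ^ i *ᵥ v) := by
    intro A
    have hd : A.charpoly.natDegree = m := by simp
    have hc : A.charpoly.coeff m = 1 :=
      (congrArg A.charpoly.coeff hd).symm.trans A.charpoly_monic
    have h0 := A.aeval_self_charpoly
    rw [aeval_eq_sum_range, hd, Finset.sum_range_succ, hc, one_smul] at h0
    have h1 := congrArg (fun B => B *ᵥ v) h0
    simp only [add_mulVec, sum_mulVec, smul_mulVec, zero_mulVec] at h1
    exact eq_neg_of_add_eq_zero_right h1
  have hm : g ^ m *ᵥ v = h ^ m *ᵥ v := by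
    rw [hCH g, hCH h, ← hP]
    congr 1
    exact Finset.sum_congr rfl fun i hi => by rw [hk i (Finset.mem_range.1 hi)]
  have hspan : Submodule.span K (Set.range fun i : Fin m => (g ^ (i : ℕ)) *ᵥ v) = ⊤ :=
    hv.span_eq_top_of_card_eq_finrank' (by simp)
  apply Matrix.toLin'.injective
  refine LinearMap.ext_on_range hspan fun i => ?_
  rw [toLin'_apply, toLin'_apply, mulVec_mulVec, ← pow_succ', hk i i.2, mulVec_mulVec,
    ← pow_succ']
  rcases (Nat.succ_le_of_lt i.2).lt_or_eq with h' | h'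
  · exact hk _ h'
  · rw [← Nat.succ_eq_add_one, h']
    exact hm

theorem charpoly_eq_of_SL_four {K : Type*} [Field K] (g : SpecialLinearGroup (Fin 4) K) :
    (g : Matrix (Fin 4) (Fin 4) K).charpoly =
      X ^ 4 + C ((g : Matrix (Fin 4) (Fin 4) K).charpoly.coeff 3) * X ^ 3 +
        C ((g : Matrix (Fin 4) (Fin 4) K).charpoly.coeff 2) * X ^ 2 +
        C ((g : Matrix (Fin 4) (Fin 4) K).charpoly.coeff 1) * X + 1 := by
  set P := (g : Matrix (Fin 4) (Fin 4) K).charpoly with hP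
  have hd : P.natDegree = 4 := by simp [hP]
  have h0 : P.coeff 0 = 1 := by
    have h := det_eq_sign_charpoly_coeff (g : Matrix (Fin 4) (Fin 4) K)
    rw [g.det_coe, Fintype.card_fin] at h
    rw [h, hP]
    norm_num
  have h4 : P.coeff 4 = 1 := by
    conv_lhs => rw [← hd]
    exact charpoly_monic _
  conv_lhs => rw [P.as_sum_range_C_mul_X_pow, hd]
  simp only [Finset.sum_range_succ, Finset.sum_range_zero, h0, h4, map_one]
  ring

theorem card_not_cyclic_mul_le {K : Type*} [Field K] [Finite K] {v : Fin 4 → K} (hv : v ≠ 0) :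
    {g : SpecialLinearGroup (Fin 4) K | ¬ LinearIndependent K
      (fun i : Fin 4 => ((g : Matrix (Fin 4) (Fin 4) K) ^ (i : ℕ)) *ᵥ v)}.ncard * Nat.card K ≤
      3 * Nat.card (SpecialLinearGroup (Fin 4) K) := by
  let N : ℕ → Set (SpecialLinearGroup (Fin 4) K) := fun k =>
    {g | LinearIndependent K (fun i : Fin (k + 1) => ((g : Matrix (Fin 4) (Fin 4) K) ^ (i : ℕ)) *ᵥ v) ∧
      ¬ LinearIndependent K
        (fun i : Fin (k + 2) => ((g : Matrix (Fin 4) (Fin 4) K) ^ (i : ℕ)) *ᵥ v)}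
  have hsub : {g : SpecialLinearGroup (Fin 4) K | ¬ LinearIndependent K
      (fun i : Fin 4 => ((g : Matrix (Fin 4) (Fin 4) K) ^ (i : ℕ)) *ᵥ v)} ⊆ N 0 ∪ N 1 ∪ N 2 := by
    intro g hg
    by_cases h3 : LinearIndependent K
      (fun i : Fin 3 => ((g : Matrix (Fin 4) (Fin 4) K) ^ (i : ℕ)) *ᵥ v)
    · exact Or.inr ⟨h3, hg⟩
    by_cases h2 : LinearIndependent K
      (fun i : Fin 2 => ((g : Matrix (Fin 4) (Fin 4) K) ^ (i : ℕ)) *ᵥ v)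
    · exact Or.inl (Or.inr ⟨h2, h3⟩)
    refine Or.inl (Or.inl ⟨?_, h2⟩)
    refine (linearIndependent_unique_iff (ι := Fin 1)).2 ?_
    simpa using hv
  have h0 := card_linearDependent_krylov_mul_le (m := 4) (k := 0) (by norm_num) v
  have h1 := card_linearDependent_krylov_mul_le (m := 4) (k := 1) (by norm_num) v
  have h2 := card_linearDependent_krylov_mul_le (m := 4) (k := 2) (by norm_num) v
  have hle := (Set.ncard_le_ncard hsub (Set.toFinite _)).trans
    ((Set.ncard_union_le _ _).trans (Nat.add_le_add_right (Set.ncard_union_le _ _) _))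
  refine (Nat.mul_le_mul_right _ hle).trans ?_
  rw [add_mul, add_mul]
  exact (Nat.add_le_add (Nat.add_le_add h0 h1) h2).trans (by omega)

theorem card_cyclic_not_squarefree_le {F E : Type*} [Field F] [Field E] [Algebra F E]
    [Fintype F] [FiniteDimensional F E] (v : Fin 4 → E) :
    {g : SpecialLinearGroup (Fin 4) E |
      LinearIndependent E (fun i : Fin 4 => ((g : Matrix (Fin 4) (Fin 4) E) ^ (i : ℕ)) *ᵥ v) ∧
      ¬ Squarefree ((Matrix.toLin' (g : Matrix (Fin 4) (Fin 4) E)).restrictScalars F).charpoly}.ncard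
      ≤ 8 * Module.finrank F E * Fintype.card F ^ (Module.finrank F E / 2) * Nat.card E ^ 14 := by
  classical
  have : Finite E := Module.finite_of_finite F
  have := Fintype.ofFinite E
  set q := Fintype.card F with hq
  set n := Module.finrank F E with hn
  have hq2 : 2 ≤ q := Fintype.one_lt_card
  have hn1 : 0 < n := Module.finrank_pos
  set A := {g : SpecialLinearGroup (Fin 4) E |
      LinearIndependent E (fun i : Fin 4 => ((g : Matrix (Fin 4) (Fin 4) E) ^ (i : ℕ)) *ᵥ v) ∧
      ¬ Squarefree ((Matrix.toLin' (g : Matrix (Fin 4) (Fin 4) E)).restrictScalars F).charpoly}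

  let L := AlgebraicClosure E
  let S₀ : E → E → Set E := fun a b => {c : E | ∃ x : L,
      aeval x (X ^ 4 + C a * X ^ 3 + C b * X ^ 2 + C c * X + 1 : E[X]) = 0 ∧
      aeval x (derivative (X ^ 4 + C a * X ^ 3 + C b * X ^ 2 + C c * X + 1 : E[X])) = 0}
  let S : ℕ → E → E → Set E := fun s a b => {c : E | ∃ x : L,
      aeval x (X ^ 4 + C a * X ^ 3 + C b * X ^ 2 + C c * X + 1 : E[X]) = 0 ∧
      aeval x (X ^ 4 + C (a ^ s) * X ^ 3 + C (b ^ s) * X ^ 2 + C (c ^ s) * X + 1 : E[X]) = 0}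
  let U : E → E → Set E := fun a b => S₀ a b ∪ ⋃ d ∈ Finset.Icc 1 (n / 2), S (q ^ d) a b
  have hU : ∀ a b, (U a b).ncard ≤ 8 * n * q ^ (n / 2) := by
    intro a b
    have hpos : 1 ≤ q ^ (n / 2) := Nat.one_le_pow _ _ (by omega)
    have h1 : (⋃ d ∈ Finset.Icc 1 (n / 2), S (q ^ d) a b).ncard ≤ n / 2 * (4 * q ^ (n / 2)) := by
      refine (Finset.set_ncard_biUnion_le _ _).trans 
        ((Finset.sum_le_card_nsmul _ _ (4 * q ^ (n / 2)) ?_).trans ?_)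
      · intro d hd
        rw [Finset.mem_Icc] at hd
        refine (card_commonRoot_frobenius_le L a b
          (hq2.trans (Nat.le_self_pow (by omega) q))).trans ?_
        exact Nat.mul_le_mul_left _ (Nat.pow_le_pow_right (by omega) hd.2)
      · simp
    have h2 := (Set.ncard_union_le (S₀ a b) (⋃ d ∈ Finset.Icc 1 (n / 2), S (q ^ d) a b)).trans
      (Nat.add_le_add (card_multipleRoot_le L a b) h1)
    refine h2.trans ?_
    have h3 : n / 2 ≤ n := Nat.div_le_self _ _
    nlinarith [Nat.mul_le_mul h3 (le_refl (4 * q ^ (n / 2))), Nat.mul_le_mul hn1 hpos]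
  have hmem : ∀ g ∈ A, (g : Matrix (Fin 4) (Fin 4) E).charpoly.coeff 1 ∈
      U ((g : Matrix (Fin 4) (Fin 4) E).charpoly.coeff 3)
        ((g : Matrix (Fin 4) (Fin 4) E).charpoly.coeff 2) := by
    intro g hg
    by_contra hc
    apply hg.2
    simp only [U, Set.mem_union, Set.mem_iUnion, not_or, not_exists] at hc
    have hP := charpoly_eq_of_SL_four g
    refine squarefree_charpoly_restrictScalars hg.1 ?_ fun d hd1 hd2 => ?_
    · refine (isCoprime_iff_aeval_ne_zero_of_isAlgClosed E L _ _).2 fun x => ?_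
      by_contra! hx
      rw [hP] at hx
      exact hc.1 ⟨x, hx⟩
    · refine (isCoprime_iff_aeval_ne_zero_of_isAlgClosed E L _ _).2 fun x => ?_
      by_contra! hx
      refine hc.2 d (Finset.mem_Icc.2 ⟨hd1, hd2⟩) ⟨x, ?_⟩
      have hφ : ∀ y : E, (FiniteField.frobeniusAlgHom F E ^ d : E →ₐ[F] E) y = y ^ q ^ d := by
        intro y
        rw [AlgHom.coe_pow, FiniteField.coe_frobeniusAlgHom, pow_iterate]
      rw [hP] at hx
      simpa [hφ] using hx
  let f : SpecialLinearGroup (Fin 4) E → (Fin 3 → Fin 4 → E) × E × E := fun g =>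
    (fun i => ((g : Matrix (Fin 4) (Fin 4) E) ^ ((i : ℕ) + 1)) *ᵥ v,
      (g : Matrix (Fin 4) (Fin 4) E).charpoly.coeff 3,
      (g : Matrix (Fin 4) (Fin 4) E).charpoly.coeff 2)
  rw [Set.ncard_eq_toFinset_card A]
  have hcard := Finset.card_le_mul_card_image (f := f) A.toFinite.toFinset (8 * n * q ^ (n / 2)) ?_
  · refine hcard.trans (Nat.mul_le_mul_left _ ((Finset.card_le_univ _).trans_eq ?_))
    simp only [Fintype.card_prod, Fintype.card_fun, Fintype.card_fin, Nat.card_eq_fintype_card]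
    ring
  · intro y _
    refine le_trans ?_ (hU y.2.1 y.2.2)
    rw [Set.ncard_eq_toFinset_card (U y.2.1 y.2.2)]
    refine Finset.card_le_card_of_injOn
      (fun g => (g : Matrix (Fin 4) (Fin 4) E).charpoly.coeff 1) ?_ ?_
    · intro g hg
      simp only [Finset.coe_filter, Set.Finite.mem_toFinset, Set.mem_ofPred_eq] at hg
      obtain ⟨hg, rfl⟩ := hg
      simpa using hmem g hg
    · intro g hg g' hg' h1
      simp only [Finset.coe_filter, Set.Finite.mem_toFinset, Set.mem_ofPred_eq] at hg hg'
      obtain ⟨hgA, rfl⟩ := hg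
      have hf := hg'.2
      have h3 : (g' : Matrix (Fin 4) (Fin 4) E).charpoly.coeff 3 =
        (g : Matrix (Fin 4) (Fin 4) E).charpoly.coeff 3 := congrArg (fun p => p.2.1) hf
      have h2 : (g' : Matrix (Fin 4) (Fin 4) E).charpoly.coeff 2 =
        (g : Matrix (Fin 4) (Fin 4) E).charpoly.coeff 2 := congrArg (fun p => p.2.2) hf
      apply Subtype.ext
      refine eq_of_charpoly_eq_of_krylov_eq hgA.1 ?_ ?_
      · rw [charpoly_eq_of_SL_four g, charpoly_eq_of_SL_four g', h3, h2]
        dsimp only at h1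
        rw [h1]
      · intro i hi
        rcases i with _ | i
        · simp
        · exact (congrArg (fun p => p.1 ⟨i, by omega⟩) hf).symm


/-- **Lemma (ss)**: there is an absolute constant `C` such that for every degree-`n`
extension `E/F` of the finite field `F` with `q` elements, the number of `g ∈ SL(4, E)`
such that the `F`-linear map `i(g)` obtained by restriction of scalars is not regular
semisimple (its characteristic polynomial over `F` is not squarefree) is at most
`C·n·q^{-n/2}·|SL(4, E)|`. -/
theorem statement6 :
    ∃ C : ℝ, 0 < C ∧
      ∀ (q n : ℕ) (F E : Type) [Field F] [Field E] [Algebra F E] [Fintype F]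
        [FiniteDimensional F E],
        Fintype.card F = q → Module.finrank F E = n →
        (Nat.card {g : Matrix.SpecialLinearGroup (Fin 4) E //
            ¬ Squarefree (LinearMap.charpoly (restrictScalarsEmbedding F E g))} : ℝ)
          ≤ C * n * (q : ℝ) ^ (-(n : ℝ) / 2) *
            (Nat.card (Matrix.SpecialLinearGroup (Fin 4) E) : ℝ) := by
  refine ⟨131, by norm_num, ?_⟩
  intro q n F E _ _ _ _ _ hq hn
  have : Finite E := Module.finite_of_finite F
  have hq1 : 1 ≤ q := hq ▸ Fintype.card_pos
  have hn1 : 1 ≤ n := hn ▸ Module.finrank_pos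
  have hv : (Pi.single 0 1 : Fin 4 → E) ≠ 0 := by simp
  have h1 := card_not_cyclic_mul_le hv
  have h2 := card_cyclic_not_squarefree_le (F := F) (Pi.single 0 1 : Fin 4 → E)
  have h3 := card_pow_le_card_SL_four E
  have hQ : Nat.card E = q ^ n := by
    rw [Module.natCard_eq_pow_finrank (K := F), Nat.card_eq_fintype_card, hq, hn]
  rw [hq, hn] at h2
  set A := {g : Matrix.SpecialLinearGroup (Fin 4) E | ¬ LinearIndependent E
      (fun i : Fin 4 => ((g : Matrix (Fin 4) (Fin 4) E) ^ (i : ℕ)) *ᵥ (Pi.single 0 1))}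
  set B := {g : Matrix.SpecialLinearGroup (Fin 4) E | LinearIndependent E
      (fun i : Fin 4 => ((g : Matrix (Fin 4) (Fin 4) E) ^ (i : ℕ)) *ᵥ (Pi.single 0 1)) ∧
      ¬ Squarefree ((Matrix.toLin' (g : Matrix (Fin 4) (Fin 4) E)).restrictScalars F).charpoly}
  have h4 : Nat.card {g : Matrix.SpecialLinearGroup (Fin 4) E //
      ¬ Squarefree (LinearMap.charpoly (restrictScalarsEmbedding F E g))} ≤ A.ncard + B.ncard := by
    refine le_trans ?_ (Set.ncard_union_le A B)
    rw [← Set.coe_ofPred, Nat.card_coe_set_eq]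
    refine Set.ncard_le_ncard (fun g hg => ?_) (Set.toFinite _)
    exact (em _).elim (fun h => Or.inr ⟨h, hg⟩) Or.inl
  set s := Nat.card (Matrix.SpecialLinearGroup (Fin 4) E)
  set Q := Nat.card E
  have hq0 : (1 : ℝ) ≤ q := by exact_mod_cast hq1
  have hn0 : (1 : ℝ) ≤ n := by exact_mod_cast hn1
  set r : ℝ := (q : ℝ) ^ (-(n : ℝ) / 2) with hr
  have hr0 : 0 < r := Real.rpow_pos_of_pos (by linarith) _
  have hr1 : r ≤ 1 := Real.rpow_le_one_of_one_le_of_nonpos hq0 (by linarith)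
  have hrQ : r * r * (Q : ℝ) = 1 := by
    rw [hQ, hr, ← Real.rpow_add (by linarith), Nat.cast_pow, ← Real.rpow_natCast,
      ← Real.rpow_add (by linarith)]
    convert Real.rpow_zero _ using 2
    ring
  have hhalf : ((q ^ (n / 2) : ℕ) : ℝ) ≤ r * Q := by
    rw [hQ, hr, Nat.cast_pow, Nat.cast_pow, ← Real.rpow_natCast, ← Real.rpow_natCast,
      ← Real.rpow_add (by linarith)]
    refine Real.rpow_le_rpow_of_exponent_le hq0 ?_
    have := Nat.cast_div_le (α := ℝ) (m := n) (n := 2)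
    push_cast at this
    linarith
  have g1 : (A.ncard : ℝ) * Q ≤ 3 * s := by exact_mod_cast h1
  have g2 : (B.ncard : ℝ) ≤ 8 * n * ((q ^ (n / 2) : ℕ) : ℝ) * Q ^ 14 := by exact_mod_cast h2
  have g3 : (Q : ℝ) ^ 15 ≤ 16 * s := by exact_mod_cast h3
  have g4 : (Nat.card {g : Matrix.SpecialLinearGroup (Fin 4) E //
      ¬ Squarefree (LinearMap.charpoly (restrictScalarsEmbedding F E g))} : ℝ) ≤
        A.ncard + B.ncard := by exact_mod_cast h4
  have hs0 : (0 : ℝ) ≤ s := Nat.cast_nonneg _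
  have k1 : (A.ncard : ℝ) ≤ 3 * n * r * s :=
    calc (A.ncard : ℝ) = (r * r) * (A.ncard * Q) := by linear_combination (-(A.ncard : ℝ)) * hrQ
      _ ≤ (r * r) * (3 * s) := by gcongr
      _ ≤ (1 * r) * (3 * s) := by gcongr
      _ ≤ (n * r) * (3 * s) := by gcongr
      _ = 3 * n * r * s := by ring
  have k2 : (B.ncard : ℝ) ≤ 128 * n * r * s :=
    calc (B.ncard : ℝ) ≤ 8 * n * ((q ^ (n / 2) : ℕ) : ℝ) * Q ^ 14 := g2
      _ ≤ 8 * n * (r * Q) * Q ^ 14 := by gcongr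
      _ = 8 * n * r * Q ^ 15 := by ring
      _ ≤ 8 * n * r * (16 * s) := by gcongr
      _ = 128 * n * r * s := by ring
  linarith
end

section
/- There is an absolute constant C such that the following holds. Let F be a finite field of cardinality q, let E be a field extension of F of degree n, and let i : SL(4, E) → SL(4n, F) be the restriction-of-scalars embedding. Then for every regular semisimple element g ∈ SL(4, E), the number of SL(4, E)-conjugacy classes of elements h ∈ SL(4, E) such that i(h) is conjugate to i(g) in SL(4n, F) is at most C·n³. -/
open Polynomial

section PolynomialModules

variable {K : Type*} [Field K]

/-- An irreducible factor of the characteristic polynomial divides the minimal polynomial. -/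
theorem LinearMap.dvd_minpoly_of_irreducible_of_dvd_charpoly {V : Type*} [AddCommGroup V]
    [Module K V] [FiniteDimensional K V] (f : Module.End K V) {p : K[X]} (hp : Irreducible p)
    (h : p ∣ f.charpoly) : p ∣ minpoly K f := by
  let A := AlgebraicClosure K
  obtain ⟨a, ha⟩ := IsAlgClosed.exists_aeval_eq_zero A p
    (fun h0 => hp.not_isUnit (isUnit_iff_degree_eq_zero.2 h0))
  have hroot : (LinearMap.charpoly (f.baseChange A)).IsRoot a := by
    rw [LinearMap.charpoly_baseChange, IsRoot.def, eval_map_algebraMap]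
    exact aeval_eq_zero_of_dvd_aeval_eq_zero h ha
  obtain ⟨x, hx⟩ :=
    ((Module.End.hasEigenvalue_iff_isRoot_charpoly _ _).2 hroot).exists_hasEigenvector
  have h1 := Module.End.aeval_apply_of_hasEigenvector
    (p := (minpoly K f).map (algebraMap K A)) hx
  have h2 : aeval (f.baseChange A) ((minpoly K f).map (algebraMap K A)) = 0 := by
    rw [aeval_map_algebraMap]
    have := aeval_algHom_apply (Module.End.baseChangeHom K A V) f (minpoly K f)
    rw [minpoly.aeval, map_zero] at this
    exact this
  rw [h2, LinearMap.zero_apply, eq_comm, smul_eq_zero, or_iff_left hx.2,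
    eval_map_algebraMap] at h1
  have ha' : IsIntegral K a := Algebra.IsIntegral.isIntegral a
  exact ((minpoly.irreducible ha').dvd_symm hp (minpoly.dvd K a ha)).trans (minpoly.dvd K a h1)

variable {M N : Type*} [AddCommGroup M] [Module K M] [Module K[X] M] [IsScalarTower K K[X] M]
  [AddCommGroup N] [Module K N] [Module K[X] N] [IsScalarTower K K[X] N]

theorem Submodule.finite_of_isScalarTower [FiniteDimensional K M] (U : Submodule K[X] M) :
    FiniteDimensional K U :=
  Module.Finite.of_injective (U.subtype.restrictScalars K) U.injective_subtype

theorem charpoly_lsmul_X_congr [FiniteDimensional K M] [FiniteDimensional K N]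
    (e : M ≃ₗ[K[X]] N) :
    LinearMap.charpoly (Algebra.lsmul K K M (X : K[X])) =
      LinearMap.charpoly (Algebra.lsmul K K N (X : K[X])) := by
  rw [← (e.restrictScalars K).charpoly_conj]
  congr 1
  ext x
  simp [LinearEquiv.conj_apply]

theorem charpoly_lsmul_X_of_isCompl [FiniteDimensional K M] {U W : Submodule K[X] M}
    [FiniteDimensional K U] [FiniteDimensional K W] (h : IsCompl U W) :
    LinearMap.charpoly (Algebra.lsmul K K M (X : K[X])) =
      LinearMap.charpoly (Algebra.lsmul K K U (X : K[X])) *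
        LinearMap.charpoly (Algebra.lsmul K K W (X : K[X])) := by
  rw [← LinearMap.charpoly_prodMap,
    ← charpoly_lsmul_X_congr (K := K) (Submodule.prodEquivOfIsCompl U W h)]
  rfl

/-- An irreducible factor of the characteristic polynomial yields a cyclic submodule. -/
theorem exists_submodule_equiv_quotient [FiniteDimensional K M] {p : K[X]} (hp : Irreducible p)
    (h : p ∣ LinearMap.charpoly (Algebra.lsmul K K M (X : K[X]))) :
    ∃ U : Submodule K[X] M, Nonempty ((K[X] ⧸ Ideal.span {p}) ≃ₗ[K[X]] U) := by
  have haeval (r : K[X]) : aeval (Algebra.lsmul K K M (X : K[X])) r = Algebra.lsmul K K M r := by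
    rw [aeval_algHom_apply, aeval_X_left_apply]
  obtain ⟨k, hk⟩ := LinearMap.dvd_minpoly_of_irreducible_of_dvd_charpoly _ hp h
  have hm0 : minpoly K (Algebra.lsmul K K M (X : K[X])) ≠ 0 :=
    minpoly.ne_zero (Algebra.IsIntegral.isIntegral _)
  have hk0 : Algebra.lsmul K K M k ≠ 0 := by
    rw [← haeval, Ne, ← minpoly.dvd_iff, hk]
    rintro ⟨c, hc⟩
    have hk0 : k ≠ 0 := by rintro rfl; simp [hk] at hm0
    refine hp.not_isUnit (.of_mul_eq_one c (mul_left_cancel₀ hk0 ?_))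
    rw [mul_one]; conv_rhs => rw [hc]
    ring
  obtain ⟨w, hw⟩ : ∃ w, k • w ≠ (0 : M) := by
    by_contra! hc
    exact hk0 (LinearMap.ext hc)
  have hpv : p • k • w = 0 := by
    have := LinearMap.congr_fun (minpoly.aeval K (Algebra.lsmul K K M (X : K[X]))) w
    rw [haeval, hk] at this
    simpa [mul_smul] using this
  have htors : Ideal.torsionOf K[X] M (k • w) = Ideal.span {p} := by
    refine (((PrincipalIdealRing.isMaximal_of_irreducible hp).eq_of_le ?_ ?_)).symm
    · rwa [Ne, Ideal.torsionOf_eq_top_iff]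
    · rw [Ideal.span_singleton_le_iff_mem]
      exact hpv
  exact ⟨_, ⟨(Submodule.quotEquivOfEq _ _ htors.symm).trans
    (Ideal.quotTorsionOfEquivSpanSingleton K[X] M (k • w))⟩⟩

theorem exists_irreducible_dvd_charpoly_lsmul_X [FiniteDimensional K M] [Nontrivial M] :
    ∃ p, Irreducible p ∧ p ∣ LinearMap.charpoly (Algebra.lsmul K K M (X : K[X])) := by
  refine WfDvdMonoid.exists_irreducible_factor (fun hu => ?_) (LinearMap.charpoly_monic _).ne_zero
  have h1 := LinearMap.charpoly_natDegree (Algebra.lsmul K K M (X : K[X]))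
  rw [natDegree_eq_zero_of_isUnit hu] at h1
  exact Module.finrank_pos.ne h1

/-- Semisimple polynomial modules with equal characteristic polynomials are isomorphic. -/
theorem nonempty_linearEquiv_of_charpoly_eq {M N : Type*}
    [AddCommGroup M] [Module K M] [Module K[X] M] [IsScalarTower K K[X] M]
    [AddCommGroup N] [Module K N] [Module K[X] N] [IsScalarTower K K[X] N]
    [FiniteDimensional K M] [FiniteDimensional K N]
    [IsSemisimpleModule K[X] M] [IsSemisimpleModule K[X] N]
    (h : LinearMap.charpoly (Algebra.lsmul K K M (X : K[X])) =
      LinearMap.charpoly (Algebra.lsmul K K N (X : K[X]))) :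
    Nonempty (M ≃ₗ[K[X]] N) := by
  induction hn : Module.finrank K M using Nat.strong_induction_on generalizing M N with
  | _ n ih =>
  have hdim : Module.finrank K M = Module.finrank K N := by
    rw [← LinearMap.charpoly_natDegree (Algebra.lsmul K K M (X : K[X])), h,
      LinearMap.charpoly_natDegree]
  rcases subsingleton_or_nontrivial M with hM | hM
  · have : Subsingleton N := by
      rw [← Module.finrank_zero_iff (R := K), ← hdim, Module.finrank_zero_iff]
      exact hM
    exact ⟨0⟩
  obtain ⟨p, hp, hpM⟩ := exists_irreducible_dvd_charpoly_lsmul_X (K := K) (M := M)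
  obtain ⟨U, ⟨eU⟩⟩ := exists_submodule_equiv_quotient hp hpM
  obtain ⟨U', ⟨eU'⟩⟩ := exists_submodule_equiv_quotient hp (h ▸ hpM)
  obtain ⟨W, hW⟩ := exists_isCompl U
  obtain ⟨W', hW'⟩ := exists_isCompl U'
  have := U.finite_of_isScalarTower (K := K)
  have := U'.finite_of_isScalarTower (K := K)
  have := W.finite_of_isScalarTower (K := K)
  have := W'.finite_of_isScalarTower (K := K)
  have : Nontrivial U := by
    have := Ideal.Quotient.nontrivial_iff.2 (PrincipalIdealRing.isMaximal_of_irreducible hp).ne_top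
    exact eU.symm.toEquiv.nontrivial
  have hsum := ((Submodule.prodEquivOfIsCompl U W hW).restrictScalars K).finrank_eq
  rw [Module.finrank_prod] at hsum
  have hpos : 0 < Module.finrank K U := Module.finrank_pos
  rw [charpoly_lsmul_X_of_isCompl hW, charpoly_lsmul_X_of_isCompl hW',
    charpoly_lsmul_X_congr (eU.symm.trans eU')] at h
  obtain ⟨e⟩ := ih _ (by omega) (mul_left_cancel₀ (LinearMap.charpoly_monic _).ne_zero h) rfl
  exact ⟨(Submodule.prodEquivOfIsCompl U W hW).symm.trans
    (((eU.symm.trans eU').prodCongr e).trans (Submodule.prodEquivOfIsCompl U' W' hW'))⟩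

/-- Over a finite field, determinants of automorphisms of a nonzero semisimple polynomial module
attain every nonzero value. -/
theorem exists_linearEquiv_det_eq [Finite K] [FiniteDimensional K M] [Nontrivial M]
    [IsSemisimpleModule K[X] M] {c : K} (hc : c ≠ 0) :
    ∃ e : M ≃ₗ[K[X]] M, LinearMap.det (e.restrictScalars K : M →ₗ[K] M) = c := by
  obtain ⟨p, hp, hpM⟩ := exists_irreducible_dvd_charpoly_lsmul_X (K := K) (M := M)
  obtain ⟨U, ⟨eU⟩⟩ := exists_submodule_equiv_quotient hp hpM
  obtain ⟨W, hW⟩ := exists_isCompl U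
  have := U.finite_of_isScalarTower (K := K)
  have := W.finite_of_isScalarTower (K := K)
  have hmax := PrincipalIdealRing.isMaximal_of_irreducible hp
  let := Ideal.Quotient.field (Ideal.span {p})
  have : FiniteDimensional K (K[X] ⧸ Ideal.span {p}) :=
    Module.Finite.equiv (eU.restrictScalars K).symm
  have : Finite (K[X] ⧸ Ideal.span {p}) := Module.finite_of_finite K
  obtain ⟨a, ha⟩ := FiniteField.norm_surjective K (K[X] ⧸ Ideal.span {p}) c
  have ha0 : a ≠ 0 := by
    rintro rfl
    exact hc (by rw [← ha, Algebra.norm_zero])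
  let μ : (K[X] ⧸ Ideal.span {p}) ≃ₗ[K[X]] (K[X] ⧸ Ideal.span {p}) :=
    LinearEquiv.smulOfNeZero _ _ a ha0 |>.restrictScalars K[X]
  let φ : (U × W) ≃ₗ[K[X]] (U × W) := ((eU.symm.trans μ).trans eU).prodCongr (.refl _ _)
  let E := Submodule.prodEquivOfIsCompl U W hW
  refine ⟨(E.symm.trans φ).trans E, ?_⟩
  have h1 := LinearMap.det_conj (φ.restrictScalars K : (U × W) →ₗ[K] (U × W)) (E.restrictScalars K)
  refine Eq.trans h1 ?_
  have h2 := LinearMap.det_prodMap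
    ((((eU.symm.trans μ).trans eU).restrictScalars K : U ≃ₗ[K] U) : U →ₗ[K] U)
    (LinearMap.id : W →ₗ[K] W)
  refine Eq.trans h2 ?_
  rw [LinearMap.det_id, mul_one]
  refine (LinearMap.det_conj (μ.restrictScalars K : _ →ₗ[K] _) (eU.restrictScalars K)).trans ?_
  rw [← ha, Algebra.norm_apply]
  rfl

end PolynomialModules

theorem charpoly_lsmul_X_aeval {K V : Type*} [Field K] [AddCommGroup V] [Module K V]
    [FiniteDimensional K V] (f : Module.End K V) :
    LinearMap.charpoly (Algebra.lsmul K K (Module.AEval' f) (X : K[X])) =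
      LinearMap.charpoly f := by
  rw [← (Module.AEval'.of f).charpoly_conj f]
  congr 1
  ext x
  simp [LinearEquiv.conj_apply, ← Module.AEval'.X_smul_of]

/-- Over a finite field, semisimple elements of `SL` with equal characteristic polynomials are
conjugate in `SL`. -/
theorem Matrix.SpecialLinearGroup.isConj_of_charpoly_eq {K ι : Type*} [Field K] [Finite K]
    [Fintype ι] [DecidableEq ι] [Nonempty ι] {g h : Matrix.SpecialLinearGroup ι K}
    (hg : Module.End.IsSemisimple (Matrix.toLin' (g : Matrix ι ι K)))
    (hh : Module.End.IsSemisimple (Matrix.toLin' (h : Matrix ι ι K)))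
    (heq : (g : Matrix ι ι K).charpoly = (h : Matrix ι ι K).charpoly) : IsConj g h := by
  let f := Matrix.toLin' (g : Matrix ι ι K)
  let f' := Matrix.toLin' (h : Matrix ι ι K)
  have : IsSemisimpleModule K[X] (Module.AEval' f) := hg
  have : IsSemisimpleModule K[X] (Module.AEval' f') := hh
  obtain ⟨e⟩ : Nonempty (Module.AEval' f ≃ₗ[K[X]] Module.AEval' f') := by
    apply nonempty_linearEquiv_of_charpoly_eq (K := K)
    rw [charpoly_lsmul_X_aeval, charpoly_lsmul_X_aeval, Matrix.charpoly_toLin',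
      Matrix.charpoly_toLin', heq]
  let E : (ι → K) ≃ₗ[K] (ι → K) := (Module.AEval'.of f).trans
    ((e.restrictScalars K).trans (Module.AEval'.of f').symm)
  have hE : IsUnit (LinearMap.det (E : (ι → K) →ₗ[K] (ι → K))) := E.isUnit_det'
  have : Nontrivial (Module.AEval' f) := (Module.AEval'.of f).symm.toEquiv.nontrivial
  obtain ⟨d, hd⟩ := exists_linearEquiv_det_eq (K := K) (M := Module.AEval' f)
    (inv_ne_zero hE.ne_zero)
  let D : (ι → K) ≃ₗ[K] (ι → K) := (Module.AEval'.of f).trans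
    ((d.restrictScalars K).trans (Module.AEval'.of f).symm)
  have hD : LinearMap.det (D : (ι → K) →ₗ[K] (ι → K)) =
      (LinearMap.det (E : (ι → K) →ₗ[K] (ι → K)))⁻¹ := by
    rw [← hd]
    exact LinearMap.det_conj (d.restrictScalars K : Module.AEval' f →ₗ[K] Module.AEval' f)
      (Module.AEval'.of f).symm
  let T : (ι → K) →ₗ[K] (ι → K) := (E : (ι → K) →ₗ[K] (ι → K)) ∘ₗ (D : (ι → K) →ₗ[K] (ι → K))
  have hT : LinearMap.det T = 1 := by
    rw [LinearMap.det_comp, hD, mul_inv_cancel₀ hE.ne_zero]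
  have hDf (v : ι → K) : D (f v) = f (D v) := by
    simp only [D, LinearEquiv.trans_apply, LinearEquiv.restrictScalars_apply,
      ← Module.AEval'.X_smul_of, map_smul, Module.AEval'.of_symm_X_smul]
  have hEf (v : ι → K) : E (f v) = f' (E v) := by
    simp only [E, LinearEquiv.trans_apply, LinearEquiv.restrictScalars_apply,
      ← Module.AEval'.X_smul_of, map_smul, Module.AEval'.of_symm_X_smul]
  have hTf : T ∘ₗ f = f' ∘ₗ T := by
    ext1 v
    exact LinearMap.ext fun v => by simp [T, hDf, hEf]
  rw [isConj_iff]
  let t : Matrix.SpecialLinearGroup ι K :=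
    ⟨LinearMap.toMatrix' T, by rw [LinearMap.det_toMatrix', hT]⟩
  refine ⟨t, ?_⟩
  rw [mul_inv_eq_iff_eq_mul]
  apply Subtype.ext
  have := congrArg LinearMap.toMatrix' hTf
  simp only [LinearMap.toMatrix'_comp, f, f', LinearMap.toMatrix'_toLin'] at this
  exact this

section RestrictScalars

variable {F E V : Type*} [Field F] [Field E] [Algebra F E] [AddCommGroup V] [Module E V]
  [Module F V] [IsScalarTower F E V]

theorem Module.End.aeval_restrictScalars (f : Module.End E V) (r : F[X]) :
    aeval (LinearMap.restrictScalars F f : Module.End F V) r =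
      LinearMap.restrictScalars F (aeval f (r.map (algebraMap F E))) := by
  induction r using Polynomial.induction_on' with
  | add p q hp hq =>
    rw [map_add, hp, hq, Polynomial.map_add, map_add]
    rfl
  | monomial n a =>
    have hpow : (LinearMap.restrictScalars F f : Module.End F V) ^ n =
        LinearMap.restrictScalars F (f ^ n) := by
      ext v
      simp [Module.End.pow_apply]
    rw [aeval_monomial, map_monomial, aeval_monomial, hpow]
    ext v
    simp [Module.algebraMap_end_apply]

theorem Module.End.minpoly_restrictScalars_dvd_iff (f : Module.End E V) (r : F[X]) :
    minpoly F (LinearMap.restrictScalars F f : Module.End F V) ∣ r ↔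
      minpoly E f ∣ r.map (algebraMap F E) := by
  rw [minpoly.dvd_iff, minpoly.dvd_iff, aeval_restrictScalars]
  exact (LinearMap.restrictScalars_injective F).eq_iff (b := 0)

theorem Module.End.squarefree_minpoly_restrictScalars [FiniteDimensional F V] {f : Module.End E V}
    (hf : Squarefree (minpoly E f)) :
    Squarefree (minpoly F (LinearMap.restrictScalars F f : Module.End F V)) := by
  rintro x ⟨y, hy⟩
  have h0 : minpoly F (LinearMap.restrictScalars F f : Module.End F V) ≠ 0 :=
    minpoly.ne_zero (Algebra.IsIntegral.isIntegral _)
  have hdvd : minpoly F (LinearMap.restrictScalars F f : Module.End F V) ∣ x * y := by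
    rw [minpoly_restrictScalars_dvd_iff, ← hf.dvd_pow_iff_dvd two_ne_zero, ← Polynomial.map_pow,
      ← minpoly_restrictScalars_dvd_iff, hy]
    exact ⟨y, by ring⟩
  rw [hy] at hdvd h0
  obtain ⟨c, hc⟩ := hdvd
  refine .of_mul_eq_one c (mul_left_cancel₀ (right_ne_zero_of_mul h0)
    (mul_left_cancel₀ (left_ne_zero_of_mul (left_ne_zero_of_mul h0)) ?_))
  linear_combination -hc

end RestrictScalars

/-- A monic quartic with constant coefficient `1` over an algebraically closed field is determined
by three of its roots. -/
theorem Matrix.charpoly_eq_of_det_eq_one {A : Type*} [Field A] [IsAlgClosed A]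
    {M : Matrix (Fin 4) (Fin 4) A} (hM : M.det = 1) :
    ∃ a ∈ M.charpoly.roots, ∃ b ∈ M.charpoly.roots, ∃ c ∈ M.charpoly.roots,
      M.charpoly = (X - C a) * (X - C b) * (X - C c) * (X - C (a * b * c)⁻¹) := by
  have hcard : M.charpoly.roots.card = M.charpoly.natDegree :=
    (IsAlgClosed.splits _).natDegree_eq_card_roots.symm
  have hprod := prod_multiset_X_sub_C_of_monic_of_roots_card_eq M.charpoly_monic hcard
  rw [Matrix.det_eq_prod_roots_charpoly] at hM
  rw [Matrix.charpoly_natDegree_eq_dim, Fintype.card_fin] at hcard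
  obtain ⟨a, b, c, d, hs⟩ := Multiset.card_eq_four.1 hcard
  rw [hs] at hprod hM ⊢
  simp only [Multiset.insert_eq_cons, Multiset.map_cons, Multiset.map_singleton,
    Multiset.prod_cons, Multiset.prod_singleton] at hprod hM
  refine ⟨a, by simp, b, by simp, c, by simp, ?_⟩
  rw [inv_eq_of_mul_eq_one_right (b := d) (by linear_combination hM), ← hprod]
  ring

section RegularSemisimple

variable {F E : Type} [Field F] [Field E] [Algebra F E]

/-- If `h` is conjugate to `g` over `F`, it is annihilated by the minimal polynomial of `g` over
`F`. -/
theorem minpoly_dvd_map_minpoly_restrictScalarsEmbedding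
    {g h : Matrix.SpecialLinearGroup (Fin 4) E} (x : (Fin 4 → E) ≃ₗ[F] (Fin 4 → E))
    (hx : x.toLinearMap ∘ₗ restrictScalarsEmbedding F E h ∘ₗ x.symm.toLinearMap
      = restrictScalarsEmbedding F E g) :
    minpoly E (Matrix.toLin' (h : Matrix (Fin 4) (Fin 4) E)) ∣
      (minpoly F (restrictScalarsEmbedding F E g : Module.End F (Fin 4 → E))).map
        (algebraMap F E) := by
  rw [← Module.End.minpoly_restrictScalars_dvd_iff]
  have h1 : LinearEquiv.conjAlgEquiv F x (restrictScalarsEmbedding F E h) =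
      restrictScalarsEmbedding F E g := by
    rw [← hx]; rfl
  rw [← h1, minpoly.algEquiv_eq]
  rfl

theorem squarefree_minpoly_restrictScalarsEmbedding [FiniteDimensional F E]
    {g : Matrix.SpecialLinearGroup (Fin 4) E}
    (hg : Squarefree (g : Matrix (Fin 4) (Fin 4) E).charpoly) :
    Squarefree (minpoly F (restrictScalarsEmbedding F E g : Module.End F (Fin 4 → E))) := by
  refine Module.End.squarefree_minpoly_restrictScalars (hg.squarefree_of_dvd ?_)
  rw [← Matrix.charpoly_toLin']
  exact LinearMap.minpoly_dvd_charpoly _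

theorem natDegree_minpoly_restrictScalarsEmbedding_le [FiniteDimensional F E]
    (g : Matrix.SpecialLinearGroup (Fin 4) E) :
    (minpoly F (restrictScalarsEmbedding F E g : Module.End F (Fin 4 → E))).natDegree ≤
      4 * Module.finrank F E := by
  refine (natDegree_le_of_dvd (LinearMap.minpoly_dvd_charpoly _)
    (LinearMap.charpoly_monic _).ne_zero).trans ?_
  rw [LinearMap.charpoly_natDegree, Module.finrank_pi_fintype]
  simp

end RegularSemisimple

/-- **Lemma (glue)**: there is an absolute constant `C` such that for every degree-`n`
extension `E/F` of a finite field `F` and every regular semisimple `g ∈ SL(4, E)`,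
the number of `SL(4, E)`-conjugacy classes of elements `h ∈ SL(4, E)` whose image
under restriction of scalars is conjugate to that of `g` by a determinant-one
`F`-linear automorphism (i.e. conjugate in `SL(4n, F)`) is at most `C·n³`. -/
theorem statement7 :
    ∃ C : ℝ, 0 < C ∧
      ∀ (n : ℕ) (F E : Type) [Field F] [Field E] [Algebra F E] [Fintype F]
        [FiniteDimensional F E],
        Module.finrank F E = n →
        ∀ g : Matrix.SpecialLinearGroup (Fin 4) E,
          Squarefree (Matrix.charpoly (g : Matrix (Fin 4) (Fin 4) E)) →
          (Nat.card (ConjClasses.mk ''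
            {h : Matrix.SpecialLinearGroup (Fin 4) E |
              ∃ x : (Fin 4 → E) ≃ₗ[F] (Fin 4 → E),
                LinearMap.det x.toLinearMap = 1 ∧
                x.toLinearMap ∘ₗ restrictScalarsEmbedding F E h ∘ₗ x.symm.toLinearMap
                  = restrictScalarsEmbedding F E g}) : ℝ)
            ≤ C * n ^ 3 := by
  refine ⟨64, by norm_num, fun n F E _ _ _ _ _ hn g hg => ?_⟩
  have : Finite E := Module.finite_of_finite F
  let A := AlgebraicClosure E
  set P := minpoly F (restrictScalarsEmbedding F E g : Module.End F (Fin 4 → E)) with hP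
  have hP0 : P ≠ 0 := minpoly.ne_zero (Algebra.IsIntegral.isIntegral _)
  have hsq : Squarefree (P.map (algebraMap F E)) :=
    (PerfectField.separable_iff_squarefree.2
      (squarefree_minpoly_restrictScalarsEmbedding hg)).map.squarefree
  classical
  let S : Finset A := (P.map (algebraMap F A)).roots.toFinset
  have hS : S.card ≤ 4 * n := by
    rw [← hn]
    refine (Multiset.toFinset_card_le _).trans ((card_roots' _).trans ?_)
    rw [natDegree_map]
    exact natDegree_minpoly_restrictScalarsEmbedding_le g
  let Φ : S × S × S → A[X] := fun t =>
    (X - C t.1.1) * (X - C t.2.1.1) * (X - C t.2.2.1) * (X - C (t.1.1 * t.2.1.1 * t.2.2.1)⁻¹)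
  have key : ∀ k : ↥(ConjClasses.mk '' {h : Matrix.SpecialLinearGroup (Fin 4) E |
      ∃ x : (Fin 4 → E) ≃ₗ[F] (Fin 4 → E), LinearMap.det x.toLinearMap = 1 ∧
        x.toLinearMap ∘ₗ restrictScalarsEmbedding F E h ∘ₗ x.symm.toLinearMap
          = restrictScalarsEmbedding F E g}),
      ∃ (h : Matrix.SpecialLinearGroup (Fin 4) E) (t : S × S × S), ConjClasses.mk h = k.1 ∧
        Module.End.IsSemisimple (Matrix.toLin' (h : Matrix (Fin 4) (Fin 4) E)) ∧
        (h : Matrix (Fin 4) (Fin 4) E).charpoly.map (algebraMap E A) = Φ t := by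
    rintro ⟨_, h, ⟨x, -, hx⟩, rfl⟩
    have hdvd := minpoly_dvd_map_minpoly_restrictScalarsEmbedding x hx
    have hroots : ∀ a ∈ ((h : Matrix (Fin 4) (Fin 4) E).map (algebraMap E A)).charpoly.roots,
        a ∈ S := by
      intro a ha
      have ha' : IsIntegral E a := Algebra.IsIntegral.isIntegral a
      rw [Matrix.charpoly_map, mem_roots_map (Matrix.charpoly_monic _).ne_zero,
        ← Matrix.charpoly_toLin'] at ha
      obtain ⟨q, hq⟩ := (LinearMap.dvd_minpoly_of_irreducible_of_dvd_charpoly _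
        (minpoly.irreducible ha') (minpoly.dvd E a ha)).trans hdvd
      rw [Multiset.mem_toFinset, mem_roots_map hP0, ← aeval_def,
        ← aeval_map_algebraMap E a P, hP, hq, map_mul, minpoly.aeval, zero_mul]
    have hdet : ((h : Matrix (Fin 4) (Fin 4) E).map (algebraMap E A)).det = 1 := by
      have := (algebraMap E A).map_det (h : Matrix (Fin 4) (Fin 4) E)
      rw [h.det_coe, map_one] at this
      exact this.symm
    obtain ⟨a, ha, b, hb, c, hc, habc⟩ := Matrix.charpoly_eq_of_det_eq_one hdet
    refine ⟨h, ⟨⟨a, hroots a ha⟩, ⟨b, hroots b hb⟩, ⟨c, hroots c hc⟩⟩, rfl, ?_, ?_⟩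
    · exact Module.End.isSemisimple_of_squarefree_aeval_eq_zero hsq (minpoly.dvd_iff.1 hdvd)
    · rw [← Matrix.charpoly_map, habc]
  choose H T hH hss hT using key
  have hinj : Function.Injective T := by
    intro k k' hk
    apply Subtype.ext
    rw [← hH, ← hH, ConjClasses.mk_eq_mk_iff_isConj]
    refine Matrix.SpecialLinearGroup.isConj_of_charpoly_eq (hss k) (hss k') ?_
    apply map_injective _ (algebraMap E A).injective
    rw [hT, hT, hk]
  have hcard := Nat.card_le_card_of_injective T hinj
  have hcardS : Nat.card S = S.card := by rw [Nat.card_eq_fintype_card, Fintype.card_coe]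
  rw [Nat.card_prod, Nat.card_prod, hcardS] at hcard
  have hbound : S.card * (S.card * S.card) ≤ 64 * n ^ 3 :=
    (Nat.mul_le_mul hS (Nat.mul_le_mul hS hS)).trans_eq (by ring)
  exact_mod_cast hcard.trans hbound
end
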